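/- arXiv:2006.05408 — 2 statements merged into one kernel-verified Lean document; each statement's English description precedes it below -/
import Mathlib

section
/- Let (σ_N)_{N≥1} be a sequence of permutations, σ_N a permutation of [N]×[N], satisfying condition (C1), i.e. Z_N(σ_N)/N⁴ → 0 as N → ∞. Then for every m ≥ 1 and every map ε: [m] → {1,*}, the limit lim_{N→∞} E[ tr( (U_N^{σ_N})^{ε(1)} (U_N^{σ_N})^{ε(2)} ⋯ (U_N^{σ_N})^{ε(m)} ) ] exists and equals |NC₂^ε(m)|, the number of non-crossing pairings π of [m] with ε(π(s)) ≠ ε(s) for all s. (These are exactly the *-moments of a circular element of variance 1; in particular the limit is 0 whenever m is odd or the numbers of 1's and *'s differ.) -/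
open MeasureTheory Matrix Filter

noncomputable instance matMS (N : ℕ) : MeasurableSpace (Matrix (Fin N) (Fin N) ℂ) :=
  (inferInstance : MeasurableSpace (Fin N → Fin N → ℂ))

/-- The matrix with entries permuted by `σ`: `(U^σ)_{i,j} = U_{σ(i,j)}`. -/
def permMat {N : ℕ} (σ : Equiv.Perm (Fin N × Fin N)) (U : Matrix (Fin N) (Fin N) ℂ) :
    Matrix (Fin N) (Fin N) ℂ :=
  Matrix.of fun i j => U (σ (i, j)).1 (σ (i, j)).2

/-- `A` if `e = true` (exponent `1`), and the conjugate transpose `Aᴴ` if `e = false`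
(exponent `*`). -/
def starPow {N : ℕ} (A : Matrix (Fin N) (Fin N) ℂ) (e : Bool) : Matrix (Fin N) (Fin N) ℂ :=
  if e then A else Aᴴ

/-- `μ` is the law of an `N × N` Haar-distributed random unitary matrix:  it is a probability
measure, almost surely its realizations are unitary matrices, and it is invariant under left
translation by any unitary matrix.  These properties characterize the normalized Haar measure
of the unitary group `U(N)`. -/
def IsHaarUnitary (N : ℕ) (μ : Measure (Matrix (Fin N) (Fin N) ℂ)) : Prop :=
  IsProbabilityMeasure μ ∧
  (∀ᵐ U ∂μ, U ∈ Matrix.unitaryGroup (Fin N) ℂ) ∧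
  ∀ V ∈ Matrix.unitaryGroup (Fin N) ℂ, μ.map (fun U => V * U) = μ

/-- `Z_N(σ)`, as in condition (C1). -/
def Zcnt (N : ℕ) (σ : Equiv.Perm (Fin N × Fin N)) : ℕ :=
  (Finset.univ.filter fun x : Fin N × Fin N × Fin N × Fin N =>
    σ (x.1, x.2.1) = ((σ (x.1, x.2.2.2)).1, (σ (x.2.2.1, x.2.1)).2)).card +
  (Finset.univ.filter fun x : Fin N × Fin N × Fin N × Fin N =>
    σ (x.1, x.2.1) = ((σ (x.2.2.1, x.2.1)).1, (σ (x.1, x.2.2.2)).2)).card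

/-- The number of non-crossing pairings `π` of `{0, …, m-1}` with `ε (π s) ≠ ε s` for every `s`,
i.e. `|NC₂^ε(m)|`.  A pairing is a fixed-point-free involution; `π` is crossing when there are
`a < b < π a < π b`. -/
noncomputable def ncPairings (m : ℕ) (ε : Fin m → Bool) : ℕ :=
  Set.ncard {π : Equiv.Perm (Fin m) |
    Function.Involutive π ∧ (∀ s, π s ≠ s) ∧ (∀ s, ε (π s) ≠ ε s) ∧
    ¬ ∃ a b : Fin m, a < b ∧ b < π a ∧ π a < π b}

/-- The entry `M x y` if `e = true`, and its complex conjugate if `e = false`. -/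
def entryPow {N : ℕ} (M : Matrix (Fin N) (Fin N) ℂ) (e : Bool) (x y : Fin N) : ℂ :=
  if e then M x y else star (M x y)

/-- The expectation of a monomial in the entries of a random matrix and their conjugates. -/
noncomputable def mixedMoment {ι : Type*} {N : ℕ} (μ : Measure (Matrix (Fin N) (Fin N) ℂ))
    (ε : ι → Bool) (S : Finset ι) (a b : ι → Fin N) : ℂ :=
  ∫ U, ∏ s ∈ S, entryPow U (ε s) (a s) (b s) ∂μ

section Haar

variable {ι : Type*} {N : ℕ}

lemma measurable_matrix_entry (x y : Fin N) :
    Measurable fun U : Matrix (Fin N) (Fin N) ℂ => U x y :=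
  (measurable_pi_apply y).comp (measurable_pi_apply x)

lemma measurable_entryPow (e : Bool) (x y : Fin N) :
    Measurable fun U : Matrix (Fin N) (Fin N) ℂ => entryPow U e x y := by
  unfold entryPow
  cases e
  · simpa [Function.comp_def] using continuous_star.measurable.comp (measurable_matrix_entry x y)
  · simpa using measurable_matrix_entry x y

lemma measurable_prod_entryPow (ε : ι → Bool) (S : Finset ι) (a b : ι → Fin N) :
    Measurable fun U : Matrix (Fin N) (Fin N) ℂ => ∏ s ∈ S, entryPow U (ε s) (a s) (b s) :=
  Finset.measurable_prod _ fun _ _ => measurable_entryPow _ _ _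

lemma measurable_matrix_mul_left (V : Matrix (Fin N) (Fin N) ℂ) :
    Measurable fun U : Matrix (Fin N) (Fin N) ℂ => V * U := by
  refine measurable_pi_iff.2 fun x => measurable_pi_iff.2 fun y => ?_
  simp only [Matrix.mul_apply]
  exact Finset.measurable_sum _ fun k _ => (measurable_matrix_entry k y).const_mul _

lemma norm_entryPow (M : Matrix (Fin N) (Fin N) ℂ) (e : Bool) (x y : Fin N) :
    ‖entryPow M e x y‖ = ‖M x y‖ := by
  cases e <;> simp [entryPow]

lemma norm_entryPow_le_one {U : Matrix (Fin N) (Fin N) ℂ} (hU : U ∈ unitaryGroup (Fin N) ℂ)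
    (e : Bool) (x y : Fin N) : ‖entryPow U e x y‖ ≤ 1 := by
  rw [norm_entryPow]
  exact entry_norm_bound_of_unitary hU x y

lemma norm_prod_entryPow_le_one {U : Matrix (Fin N) (Fin N) ℂ}
    (hU : U ∈ unitaryGroup (Fin N) ℂ) (ε : ι → Bool) (S : Finset ι) (a b : ι → Fin N) :
    ‖∏ s ∈ S, entryPow U (ε s) (a s) (b s)‖ ≤ 1 := by
  rw [norm_prod]
  exact Finset.prod_le_one (fun _ _ => norm_nonneg _) fun s _ => norm_entryPow_le_one hU _ _ _

lemma exp_smul_mem_unitaryGroup {X : Matrix (Fin N) (Fin N) ℂ} (hX : Xᴴ = -X) (t : ℝ) :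
    NormedSpace.exp (t • X) ∈ unitaryGroup (Fin N) ℂ := by
  rw [mem_unitaryGroup_iff, star_eq_conjTranspose, ← Matrix.exp_conjTranspose,
    conjTranspose_smul, hX, ← Matrix.exp_add_of_commute]
  · simp
  · simp [Commute, SemiconjBy]

open scoped Norms.Operator in
lemma hasDerivAt_exp_smul_apply (X : Matrix (Fin N) (Fin N) ℂ) (t : ℝ) (x y : Fin N) :
    HasDerivAt (fun u : ℝ => NormedSpace.exp (u • X) x y) ((X * NormedSpace.exp (t • X)) x y) t := by
  have h := hasDerivAt_exp_smul_const' (𝕂 := ℝ) X t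
  exact ((Matrix.entryLinearMap ℝ ℂ x y).toContinuousLinearMap.hasFDerivAt.comp_hasDerivAt t h)

lemma hasDerivAt_entryPow_exp_mul (X U : Matrix (Fin N) (Fin N) ℂ) (t : ℝ) (e : Bool)
    (x y : Fin N) :
    HasDerivAt (fun u : ℝ => entryPow (NormedSpace.exp (u • X) * U) e x y)
      (entryPow (X * (NormedSpace.exp (t • X) * U)) e x y) t := by
  have h : HasDerivAt (fun u : ℝ => (NormedSpace.exp (u • X) * U) x y)
      ((X * (NormedSpace.exp (t • X) * U)) x y) t := by
    rw [← Matrix.mul_assoc]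
    simp only [Matrix.mul_apply (N := U)]
    exact HasDerivAt.fun_sum fun k _ => (hasDerivAt_exp_smul_apply X t x k).mul_const _
  cases e
  · simpa [entryPow] using h.star
  · simpa [entryPow] using h

variable {μ : Measure (Matrix (Fin N) (Fin N) ℂ)}

lemma IsHaarUnitary.integrable (hμ : IsHaarUnitary N μ) {f : Matrix (Fin N) (Fin N) ℂ → ℂ}
    (hf : Measurable f) {C : ℝ} (hC : ∀ U ∈ unitaryGroup (Fin N) ℂ, ‖f U‖ ≤ C) :
    Integrable f μ := by
  have := hμ.1
  exact Integrable.of_bound hf.aestronglyMeasurable C (hμ.2.1.mono hC)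

lemma IsHaarUnitary.integrable_prod (hμ : IsHaarUnitary N μ) (ε : ι → Bool) (S : Finset ι)
    (a b : ι → Fin N) : Integrable (fun U => ∏ s ∈ S, entryPow U (ε s) (a s) (b s)) μ :=
  hμ.integrable (measurable_prod_entryPow ε S a b)
    fun _ hU => norm_prod_entryPow_le_one hU ε S a b

lemma IsHaarUnitary.norm_mixedMoment_le_one (hμ : IsHaarUnitary N μ) (ε : ι → Bool)
    (S : Finset ι) (a b : ι → Fin N) : ‖mixedMoment μ ε S a b‖ ≤ 1 := by
  have := hμ.1
  refine (norm_integral_le_of_norm_le_const (C := 1)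
    (hμ.2.1.mono fun _ hU => norm_prod_entryPow_le_one hU ε S a b)).trans ?_
  simp

lemma IsHaarUnitary.mixedMoment_empty (hμ : IsHaarUnitary N μ) (ε : ι → Bool)
    (a b : ι → Fin N) : mixedMoment μ ε ∅ a b = 1 := by
  have := hμ.1
  simp [mixedMoment]

lemma IsHaarUnitary.integral_mul_left (hμ : IsHaarUnitary N μ)
    {V : Matrix (Fin N) (Fin N) ℂ} (hV : V ∈ unitaryGroup (Fin N) ℂ)
    {f : Matrix (Fin N) (Fin N) ℂ → ℂ} (hf : Measurable f) :
    ∫ U, f (V * U) ∂μ = ∫ U, f U ∂μ := by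
  conv_rhs => rw [← hμ.2.2 V hV]
  rw [integral_map (measurable_matrix_mul_left V).aemeasurable hf.aestronglyMeasurable]

lemma norm_mul_unitary_apply_le (X : Matrix (Fin N) (Fin N) ℂ) {W : Matrix (Fin N) (Fin N) ℂ}
    (hW : W ∈ unitaryGroup (Fin N) ℂ) (x y : Fin N) :
    ‖(X * W) x y‖ ≤ ∑ i, ∑ k, ‖X i k‖ := by
  rw [Matrix.mul_apply]
  calc ‖∑ k, X x k * W k y‖ ≤ ∑ k, ‖X x k * W k y‖ := norm_sum_le _ _
    _ ≤ ∑ k, ‖X x k‖ := Finset.sum_le_sum fun k _ => by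
        rw [norm_mul]
        exact mul_le_of_le_one_right (norm_nonneg _) (entry_norm_bound_of_unitary hW _ _)
    _ ≤ _ := Finset.single_le_sum (f := fun i => ∑ k, ‖X i k‖)
        (fun i _ => Finset.sum_nonneg fun k _ => norm_nonneg _) (Finset.mem_univ x)

/-- The derivative of the moments along a one-parameter group of unitaries vanishes. -/
lemma IsHaarUnitary.integral_deriv_skew [DecidableEq ι] (hμ : IsHaarUnitary N μ)
    {X : Matrix (Fin N) (Fin N) ℂ} (hX : Xᴴ = -X) (ε : ι → Bool) (S : Finset ι)
    (a b : ι → Fin N) :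
    ∫ U, ∑ s ∈ S, (∏ r ∈ S.erase s, entryPow U (ε r) (a r) (b r)) *
      entryPow (X * U) (ε s) (a s) (b s) ∂μ = 0 := by
  have := hμ.1
  set B : ℝ := ∑ i, ∑ k, ‖X i k‖ with hB
  have key := hasDerivAt_integral_of_dominated_loc_of_deriv_le (μ := μ) (𝕜 := ℝ)
    (F := fun t U => ∏ s ∈ S, entryPow (NormedSpace.exp (t • X) * U) (ε s) (a s) (b s))
    (F' := fun t U => ∑ s ∈ S,
      (∏ r ∈ S.erase s, entryPow (NormedSpace.exp (t • X) * U) (ε r) (a r) (b r)) •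
        entryPow (X * (NormedSpace.exp (t • X) * U)) (ε s) (a s) (b s))
    (x₀ := 0) (s := Set.univ) (bound := fun _ => S.card * B) Filter.univ_mem
    (Eventually.of_forall fun t => ((measurable_prod_entryPow ε S a b).comp
      (measurable_matrix_mul_left _)).aestronglyMeasurable)
    (by simpa using hμ.integrable_prod ε S a b)
    (by
      refine (Finset.measurable_sum _ fun s _ => ?_).aestronglyMeasurable
      refine Measurable.mul ((measurable_prod_entryPow ε _ a b).comp
        (measurable_matrix_mul_left _)) ?_
      exact ((measurable_entryPow _ _ _).comp (measurable_matrix_mul_left X)).comp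
        (measurable_matrix_mul_left _))
    (by
      filter_upwards [hμ.2.1] with U hU t _
      have hV := mul_mem (exp_smul_mem_unitaryGroup hX t) hU
      refine (norm_sum_le _ _).trans ?_
      rw [← nsmul_eq_mul]
      refine Finset.sum_le_card_nsmul _ _ _ fun s _ => ?_
      rw [smul_eq_mul, norm_mul, norm_entryPow]
      exact (mul_le_of_le_one_left (norm_nonneg _)
        (norm_prod_entryPow_le_one hV ε _ a b)).trans (norm_mul_unitary_apply_le X hV _ _))
    (integrable_const _)
    (Eventually.of_forall fun U t _ =>
      HasDerivAt.fun_finsetProd fun s _ => hasDerivAt_entryPow_exp_mul X U t (ε s) (a s) (b s))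
  have hconst : (fun t : ℝ => ∫ U, ∏ s ∈ S,
      entryPow (NormedSpace.exp (t • X) * U) (ε s) (a s) (b s) ∂μ) =
      fun _ => mixedMoment μ ε S a b := by
    funext t
    exact hμ.integral_mul_left (exp_smul_mem_unitaryGroup hX t) (measurable_prod_entryPow ε S a b)
  have h2 := key.2
  rw [hconst] at h2
  have h3 := h2.unique (hasDerivAt_const _ _)
  simpa using h3

/-- The complex-linear extension in `X` of `entryPow (X * U) e x y` from skew-Hermitian `X`. -/
noncomputable def entryDeriv (X U : Matrix (Fin N) (Fin N) ℂ) (e : Bool) (x y : Fin N) : ℂ :=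
  if e then ∑ k, X x k * U k y else -∑ k, X k x * star (U k y)

lemma measurable_entryDeriv (X : Matrix (Fin N) (Fin N) ℂ) (e : Bool) (x y : Fin N) :
    Measurable fun U => entryDeriv X U e x y := by
  unfold entryDeriv
  cases e
  · simp only [Bool.false_eq_true, if_false]
    exact (Finset.measurable_sum _ fun k _ =>
      (continuous_star.measurable.comp (measurable_matrix_entry k y)).const_mul _).neg
  · simp only [if_true]
    exact Finset.measurable_sum _ fun k _ => (measurable_matrix_entry k y).const_mul _

lemma entryDeriv_of_skew {X : Matrix (Fin N) (Fin N) ℂ} (hX : Xᴴ = -X)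
    (U : Matrix (Fin N) (Fin N) ℂ) (e : Bool) (x y : Fin N) :
    entryPow (X * U) e x y = entryDeriv X U e x y := by
  cases e
  · simp only [entryPow, entryDeriv, Bool.false_eq_true, if_false, Matrix.mul_apply, star_sum,
      star_mul', ← Finset.sum_neg_distrib]
    refine Finset.sum_congr rfl fun k _ => ?_
    have : star (X x k) = -X k x := by
      have := congrFun (congrFun hX k) x
      simpa using this
    rw [this, neg_mul]
  · simp [entryPow, entryDeriv, Matrix.mul_apply]

lemma entryDeriv_add_smul (X Y U : Matrix (Fin N) (Fin N) ℂ) (c : ℂ) (e : Bool) (x y : Fin N) :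
    entryDeriv (X + c • Y) U e x y = entryDeriv X U e x y + c * entryDeriv Y U e x y := by
  cases e
  · simp [entryDeriv, add_mul, Finset.sum_add_distrib, Finset.mul_sum, mul_assoc]
    ring
  · simp [entryDeriv, add_mul, Finset.sum_add_distrib, Finset.mul_sum, mul_assoc]

lemma norm_entryDeriv_le (X : Matrix (Fin N) (Fin N) ℂ) {U : Matrix (Fin N) (Fin N) ℂ}
    (hU : U ∈ unitaryGroup (Fin N) ℂ) (e : Bool) (x y : Fin N) :
    ‖entryDeriv X U e x y‖ ≤ ∑ k, (‖X x k‖ + ‖X k x‖) := by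
  have hk : ∀ k, ‖U k y‖ ≤ 1 := fun k => entry_norm_bound_of_unitary hU k y
  cases e
  · simp only [entryDeriv, Bool.false_eq_true, if_false, norm_neg]
    refine (norm_sum_le _ _).trans (Finset.sum_le_sum fun k _ => ?_)
    rw [norm_mul, norm_star]
    nlinarith [hk k, norm_nonneg (X k x), norm_nonneg (X x k), norm_nonneg (U k y)]
  · simp only [entryDeriv, if_true]
    refine (norm_sum_le _ _).trans (Finset.sum_le_sum fun k _ => ?_)
    rw [norm_mul]
    nlinarith [hk k, norm_nonneg (X k x), norm_nonneg (X x k), norm_nonneg (U k y)]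

lemma IsHaarUnitary.integrable_prod_mul_entryDeriv (hμ : IsHaarUnitary N μ)
    (X : Matrix (Fin N) (Fin N) ℂ) (ε : ι → Bool) (S : Finset ι) (a b : ι → Fin N)
    (e : Bool) (x y : Fin N) :
    Integrable (fun U => (∏ r ∈ S, entryPow U (ε r) (a r) (b r)) * entryDeriv X U e x y) μ := by
  refine hμ.integrable ((measurable_prod_entryPow ε S a b).mul (measurable_entryDeriv X e x y))
    (C := ∑ k, (‖X x k‖ + ‖X k x‖)) fun U hU => ?_
  rw [norm_mul]
  exact (mul_le_of_le_one_left (norm_nonneg _) (norm_prod_entryPow_le_one hU ε S a b)).trans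
    (norm_entryDeriv_le X hU e x y)

/-- Schwinger-Dyson equation for the Haar measure. -/
lemma IsHaarUnitary.sum_integral_entryDeriv [DecidableEq ι] (hμ : IsHaarUnitary N μ)
    (A : Matrix (Fin N) (Fin N) ℂ) (ε : ι → Bool) (S : Finset ι) (a b : ι → Fin N) :
    ∑ s ∈ S, ∫ U, (∏ r ∈ S.erase s, entryPow U (ε r) (a r) (b r)) *
      entryDeriv A U (ε s) (a s) (b s) ∂μ = 0 := by
  have hskew : ∀ X : Matrix (Fin N) (Fin N) ℂ, Xᴴ = -X →
      ∑ s ∈ S, ∫ U, (∏ r ∈ S.erase s, entryPow U (ε r) (a r) (b r)) *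
        entryDeriv X U (ε s) (a s) (b s) ∂μ = 0 := by
    intro X hX
    rw [← integral_finsetSum _ fun s _ => hμ.integrable_prod_mul_entryDeriv X ε _ a b _ _ _]
    simp only [← entryDeriv_of_skew hX]
    exact hμ.integral_deriv_skew hX ε S a b
  have h1 := hskew ((1 / 2 : ℂ) • (A - Aᴴ)) (by
    simp [conjTranspose_smul, conjTranspose_sub, ← smul_neg])
  have h2 := hskew ((-Complex.I / 2) • (A + Aᴴ)) (by
    ext i j
    simp [add_comm]
    ring)
  have hA : A = (1 / 2 : ℂ) • (A - Aᴴ) + Complex.I • ((-Complex.I / 2) • (A + Aᴴ)) := by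
    ext i j
    simp
    linear_combination (A i j / 2 + (starRingEnd ℂ) (A j i) / 2) * Complex.I_sq
  rw [hA]
  simp only [entryDeriv_add_smul, mul_add]
  have h3 : ∀ s ∈ S, ∫ U, ((∏ r ∈ S.erase s, entryPow U (ε r) (a r) (b r)) *
        entryDeriv ((1 / 2 : ℂ) • (A - Aᴴ)) U (ε s) (a s) (b s) +
      (∏ r ∈ S.erase s, entryPow U (ε r) (a r) (b r)) *
        (Complex.I * entryDeriv ((-Complex.I / 2) • (A + Aᴴ)) U (ε s) (a s) (b s))) ∂μ =
      ∫ U, (∏ r ∈ S.erase s, entryPow U (ε r) (a r) (b r)) *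
        entryDeriv ((1 / 2 : ℂ) • (A - Aᴴ)) U (ε s) (a s) (b s) ∂μ +
      Complex.I * ∫ U, (∏ r ∈ S.erase s, entryPow U (ε r) (a r) (b r)) *
        entryDeriv ((-Complex.I / 2) • (A + Aᴴ)) U (ε s) (a s) (b s) ∂μ := by
    intro s _
    simp only [mul_left_comm _ Complex.I]
    rw [integral_add (hμ.integrable_prod_mul_entryDeriv _ ε _ a b _ _ _)
      ((hμ.integrable_prod_mul_entryDeriv _ ε _ a b _ _ _).const_mul _), integral_const_mul]
  rw [Finset.sum_congr rfl h3, Finset.sum_add_distrib, ← Finset.mul_sum, h1, h2]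
  simp

end Haar

section Recursion

variable {ι : Type*} [DecidableEq ι] {N : ℕ} {μ : Measure (Matrix (Fin N) (Fin N) ℂ)}

lemma entryDeriv_single_true (k l x y : Fin N) (U : Matrix (Fin N) (Fin N) ℂ) :
    entryDeriv (Matrix.single k l 1) U true x y = if x = k then U l y else 0 := by
  simp only [entryDeriv, if_true, Matrix.single_apply]
  by_cases h : x = k
  · subst h; simp
  · simp [h, Ne.symm h]

lemma entryDeriv_single_false (k l x y : Fin N) (U : Matrix (Fin N) (Fin N) ℂ) :
    entryDeriv (Matrix.single k l 1) U false x y = if x = l then -star (U k y) else 0 := by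
  simp only [entryDeriv, Bool.false_eq_true, if_false, Matrix.single_apply]
  by_cases h : x = l
  · subst h; simp
  · simp [h, Ne.symm h]

lemma prod_erase_update_mul_swap (U : Matrix (Fin N) (Fin N) ℂ) (ε : ι → Bool) {S : Finset ι}
    (a b : ι → Fin N) {s₀ s : ι} (hs₀ : s₀ ∈ S) (hs : s ∈ S) (hne : s ≠ s₀) (hε : ε s = true) :
    (∏ r ∈ S.erase s, entryPow U (ε r) (Function.update a s₀ (a s) r) (b r)) * U (a s₀) (b s) =
      ∏ r ∈ S, entryPow U (ε r) ((a ∘ Equiv.swap s₀ s) r) (b r) := by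
  rw [← Finset.prod_erase_mul S _ hs]
  congr 1
  · refine Finset.prod_congr rfl fun r hr => ?_
    have hrs := Finset.ne_of_mem_erase hr
    by_cases h : r = s₀
    · subst h; simp
    · simp [h, Equiv.swap_apply_of_ne_of_ne h hrs]
  · simp [entryPow, hε]

lemma sum_unitary_col_mul {U : Matrix (Fin N) (Fin N) ℂ} (hU : U ∈ unitaryGroup (Fin N) ℂ)
    (x y : Fin N) : ∑ k, U k x * star (U k y) = if y = x then 1 else 0 := by
  have h := congrFun (congrFun (mem_unitaryGroup_iff'.1 hU) y) x
  rw [Matrix.mul_apply, Matrix.one_apply] at h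
  rw [← h]
  exact Finset.sum_congr rfl fun k _ => by rw [star_apply, mul_comm]

/-- Recursion for the mixed moments of the entries of a Haar unitary. -/
lemma IsHaarUnitary.mixedMoment_recursion (hμ : IsHaarUnitary N μ) (ε : ι → Bool)
    {S : Finset ι} {s₀ : ι} (hs₀ : s₀ ∈ S) (hε : ε s₀ = true) (a b : ι → Fin N) :
    N * mixedMoment μ ε S a b +
      ∑ s ∈ (S.erase s₀).filter (fun s => ε s = true),
        mixedMoment μ ε S (a ∘ Equiv.swap s₀ s) b =
    ∑ s ∈ (S.erase s₀).filter (fun s => ¬ ε s = true),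
      if a s = a s₀ ∧ b s = b s₀ then mixedMoment μ ε ((S.erase s₀).erase s) a b else 0 := by
  set I : ι → Fin N → ℂ := fun s k =>
    ∫ U, (∏ r ∈ S.erase s, entryPow U (ε r) (Function.update a s₀ k r) (b r)) *
      entryDeriv (Matrix.single k (a s₀) 1) U (ε s) (Function.update a s₀ k s) (b s) ∂μ with hI
  have hintegrable : ∀ s k, Integrable (fun U =>
      (∏ r ∈ S.erase s, entryPow U (ε r) (Function.update a s₀ k r) (b r)) *
      entryDeriv (Matrix.single k (a s₀) 1) U (ε s) (Function.update a s₀ k s) (b s)) μ :=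
    fun s k => hμ.integrable_prod_mul_entryDeriv _ ε _ _ b _ _ _
  have hzero : ∑ s ∈ S, ∑ k, I s k = 0 := by
    rw [Finset.sum_comm]
    exact Finset.sum_eq_zero fun k _ => hμ.sum_integral_entryDeriv _ ε S _ b
  have h1 : ∑ k, I s₀ k = N * mixedMoment μ ε S a b := by
    have : ∀ k, I s₀ k = mixedMoment μ ε S a b := by
      intro k
      simp only [hI, mixedMoment, hε, Function.update_self, entryDeriv_single_true, if_true]
      congr 1
      funext U
      rw [← Finset.prod_erase_mul S _ hs₀]
      congr 1
      · refine Finset.prod_congr rfl fun r hr => ?_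
        rw [Function.update_of_ne (Finset.ne_of_mem_erase hr)]
      · simp [entryPow, hε]
    simp [this]
  have h2 : ∀ s ∈ (S.erase s₀).filter (fun s => ε s = true),
      ∑ k, I s k = mixedMoment μ ε S (a ∘ Equiv.swap s₀ s) b := by
    intro s hs
    obtain ⟨hs, hεs⟩ := Finset.mem_filter.1 hs
    have hne := Finset.ne_of_mem_erase hs
    rw [Finset.sum_eq_single (a s)]
    · simp only [hI, mixedMoment, Function.update_of_ne hne, hεs, entryDeriv_single_true, if_true]
      congr 1
      funext U
      exact prod_erase_update_mul_swap U ε a b hs₀ (Finset.mem_of_mem_erase hs) hne hεs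
    · intro k _ hk
      simp [hI, Function.update_of_ne hne, hεs, entryDeriv_single_true, hk.symm]
    · simp
  have h3 : ∀ s ∈ (S.erase s₀).filter (fun s => ¬ ε s = true), ∑ k, I s k =
      -if a s = a s₀ ∧ b s = b s₀ then mixedMoment μ ε ((S.erase s₀).erase s) a b else 0 := by
    intro s hs
    obtain ⟨hs, hεs⟩ := Finset.mem_filter.1 hs
    have hεs' : ε s = false := by simpa using hεs
    have hne := Finset.ne_of_mem_erase hs
    by_cases has : a s = a s₀
    · simp only [hI]
      rw [← integral_finsetSum _ fun k _ => hintegrable s k]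
      have : ∀ᵐ U ∂μ, ∑ k, (∏ r ∈ S.erase s,
            entryPow U (ε r) (Function.update a s₀ k r) (b r)) *
          entryDeriv (Matrix.single k (a s₀) 1) U (ε s) (Function.update a s₀ k s) (b s) =
          (-if b s = b s₀ then 1 else 0) *
            ∏ r ∈ (S.erase s₀).erase s, entryPow U (ε r) (a r) (b r) := by
        filter_upwards [hμ.2.1] with U hU
        rw [← sum_unitary_col_mul hU, ← Finset.sum_neg_distrib, Finset.sum_mul]
        refine Finset.sum_congr rfl fun k _ => ?_
        have hmem : s₀ ∈ S.erase s := Finset.mem_erase.2 ⟨hne.symm, hs₀⟩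
        rw [← Finset.mul_prod_erase _ _ hmem, Function.update_of_ne hne, hεs',
          entryDeriv_single_false, if_pos has, Finset.erase_right_comm]
        have : ∏ r ∈ (S.erase s₀).erase s,
            entryPow U (ε r) (Function.update a s₀ k r) (b r) =
            ∏ r ∈ (S.erase s₀).erase s, entryPow U (ε r) (a r) (b r) :=
          Finset.prod_congr rfl fun r hr => by
            rw [Function.update_of_ne (Finset.ne_of_mem_erase (Finset.mem_of_mem_erase hr))]
        rw [this]
        simp only [entryPow, hε, Function.update_self, if_true]
        ring
      rw [integral_congr_ae this, integral_const_mul]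
      by_cases hb : b s = b s₀ <;> simp [has, hb, mixedMoment]
    · simp [hI, Function.update_of_ne hne, hεs', entryDeriv_single_false, has]
  rw [← Finset.add_sum_erase _ _ hs₀, ← Finset.sum_filter_add_sum_filter_not (S.erase s₀)
    (fun s => ε s = true), h1, Finset.sum_congr rfl h2, Finset.sum_congr rfl h3,
    Finset.sum_neg_distrib] at hzero
  linear_combination hzero

lemma IsHaarUnitary.mixedMoment_eq_zero (hμ : IsHaarUnitary N μ) (ε : ι → Bool)
    {S : Finset ι} (hS : S.Nonempty) (hε : ∀ s ∈ S, ε s = false) (a b : ι → Fin N) :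
    mixedMoment μ ε S a b = 0 := by
  have h := hμ.sum_integral_entryDeriv 1 ε S a b
  have h1 : ∀ s ∈ S, ∫ U, (∏ r ∈ S.erase s, entryPow U (ε r) (a r) (b r)) *
      entryDeriv 1 U (ε s) (a s) (b s) ∂μ = -mixedMoment μ ε S a b := by
    intro s hs
    rw [mixedMoment, ← integral_neg]
    congr 1
    funext U
    rw [← Finset.prod_erase_mul S _ hs]
    simp [entryDeriv, entryPow, hε s hs, Matrix.one_apply]
  rw [Finset.sum_congr rfl h1, Finset.sum_const, nsmul_eq_mul] at h
  have hcard : (S.card : ℂ) ≠ 0 := by exact_mod_cast hS.card_pos.ne'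
  simpa [hcard] using h

end Recursion

section Pairings

variable {ι : Type*}

/-- `α` is an involution that fixes every point outside `S`, and that pairs the points of `S`
so that the two points of each pair have different signs. -/
def IsSignPairing (ε : ι → Bool) (S : Finset ι) (α : Equiv.Perm ι) : Prop :=
  Function.Involutive α ∧ (∀ s ∈ S, ε (α s) ≠ ε s) ∧ ∀ s ∉ S, α s = s

/-- The number of classes of the equivalence relation generated by the orbits of `α` and `β`. -/
noncomputable def jointClasses (α β : Equiv.Perm ι) : ℕ :=
  Nat.card (Quot fun x y => α x = y ∨ β x = y)

/-- The indicator of the event that `a` is constant on the orbits of `α`. -/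
noncomputable def fixInd {κ : Type*} (α : Equiv.Perm ι) (a : ι → κ) : ℂ :=
  open Classical in if a ∘ α = a then 1 else 0

lemma jointClasses_comm (α β : Equiv.Perm ι) : jointClasses α β = jointClasses β α := by
  unfold jointClasses
  simp only [or_comm]

lemma fixInd_one {κ : Type*} (a : ι → κ) : fixInd 1 a = 1 := by
  simp [fixInd]

lemma fixInd_congr {κ : Type*} {α α' : Equiv.Perm ι} {a a' : ι → κ}
    (h : a ∘ α = a ↔ a' ∘ α' = a') : fixInd α a = fixInd α' a' := by
  unfold fixInd
  split_ifs <;> tauto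

namespace IsSignPairing

variable {ε : ι → Bool} {S : Finset ι} {α : Equiv.Perm ι}

lemma mem (h : IsSignPairing ε S α) {s : ι} (hs : s ∈ S) : α s ∈ S := by
  by_contra hn
  have h1 := h.2.2 _ hn
  rw [h.1 s] at h1
  exact h.2.1 s hs (congrArg ε h1.symm)

variable [DecidableEq ι]

lemma swap_conj (h : IsSignPairing ε S α) {p q : ι} (hp : p ∈ S) (hq : q ∈ S)
    (hpq : ε p = ε q) : IsSignPairing ε S (Equiv.swap p q * α * Equiv.swap p q) := by
  have hε : ∀ x, ε (Equiv.swap p q x) = ε x := fun x => by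
    rcases eq_or_ne x p with rfl | h1
    · simp [hpq]
    rcases eq_or_ne x q with rfl | h2
    · simp [hpq]
    · rw [Equiv.swap_apply_of_ne_of_ne h1 h2]
  have hS : ∀ x, Equiv.swap p q x ∈ S ↔ x ∈ S := fun x => by
    rcases eq_or_ne x p with rfl | h1
    · simp [hp, hq]
    rcases eq_or_ne x q with rfl | h2
    · simp [hp, hq]
    · rw [Equiv.swap_apply_of_ne_of_ne h1 h2]
  refine ⟨fun x => ?_, fun s hs => ?_, fun s hs => ?_⟩
  · simp [h.1 _]
  · simp only [Equiv.Perm.mul_apply, hε]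
    rw [← hε s]
    exact h.2.1 _ ((hS s).2 hs)
  · simp only [Equiv.Perm.mul_apply]
    rw [h.2.2 _ (fun h => hs ((hS s).1 h)), Equiv.swap_apply_self]

lemma swap_mul {p q : ι} (hp : p ∈ S) (hq : q ∈ S) (hpq : ε p ≠ ε q)
    (h : IsSignPairing ε ((S.erase p).erase q) α) :
    IsSignPairing ε S (Equiv.swap p q * α) := by
  have hne : p ≠ q := fun h => hpq (congrArg ε h)
  have h1 : α p = p := h.2.2 p (by simp)
  have h2 : α q = q := h.2.2 q (by simp)
  have key : ∀ x, x ≠ p → x ≠ q → Equiv.swap p q (α x) = α x := fun x hx hx' =>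
    Equiv.swap_apply_of_ne_of_ne (fun h => hx (α.injective (h.trans h1.symm)))
      fun h => hx' (α.injective (h.trans h2.symm))
  refine ⟨fun x => ?_, fun s hs => ?_, fun s hs => ?_⟩
  · simp only [Equiv.Perm.mul_apply]
    rcases eq_or_ne x p with rfl | hx
    · simp [h1, h2]
    rcases eq_or_ne x q with rfl | hx'
    · simp [h1, h2]
    rw [key x hx hx', h.1, Equiv.swap_apply_of_ne_of_ne hx hx']
  · simp only [Equiv.Perm.mul_apply]
    rcases eq_or_ne s p with rfl | hx
    · simpa [h1] using hpq.symm
    rcases eq_or_ne s q with rfl | hx'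
    · simpa [h2] using hpq
    rw [key s hx hx']
    exact h.2.1 s (by simp [hx, hx', hs])
  · simp only [Equiv.Perm.mul_apply]
    have hx : s ≠ p := fun h => hs (h ▸ hp)
    have hx' : s ≠ q := fun h => hs (h ▸ hq)
    rw [key s hx hx', h.2.2 s (by simp [hs])]

lemma erase_pair (h : IsSignPairing ε S α) {p : ι} :
    IsSignPairing ε ((S.erase p).erase (α p)) (Equiv.swap p (α p) * α) := by
  have key : ∀ x, x ≠ p → x ≠ α p → Equiv.swap p (α p) (α x) = α x := fun x hx hx' =>
    Equiv.swap_apply_of_ne_of_ne (fun h' => hx' (by rw [← h', h.1])) fun h => hx (α.injective h)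
  refine ⟨fun x => ?_, fun s hs => ?_, fun s hs => ?_⟩
  · simp only [Equiv.Perm.mul_apply]
    rcases eq_or_ne x p with rfl | hx
    · simp
    rcases eq_or_ne x (α p) with rfl | hx'
    · simp [h.1 p]
    rw [key x hx hx', h.1, Equiv.swap_apply_of_ne_of_ne hx hx']
  · simp only [Finset.mem_erase] at hs
    rw [Equiv.Perm.mul_apply, key s hs.2.1 hs.1]
    exact h.2.1 s hs.2.2
  · rw [Equiv.Perm.mul_apply]
    rcases eq_or_ne s p with rfl | hx
    · simp
    rcases eq_or_ne s (α p) with rfl | hx'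
    · simp [h.1 p]
    rw [key s hx hx']
    exact h.2.2 s (fun hs' => hs (by simp [hx, hx', hs']))

end IsSignPairing

variable [Finite ι]

/-- Identifying two classes decreases the number of classes by at most one. -/
lemma card_quot_le_add_one [DecidableEq ι] {r r' : ι → ι → Prop} (p q : ι)
    (h : ∀ x y, r' x y → Quot.mk r x = Quot.mk r y ∨
      Quot.mk r x = Quot.mk r (Equiv.swap p q y) ∨
      Quot.mk r (Equiv.swap p q x) = Quot.mk r (Equiv.swap p q y)) :
    Nat.card (Quot r) ≤ Nat.card (Quot r') + 1 := by
  classical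
  let g : Quot r → Quot r := fun z => if z = Quot.mk r p then Quot.mk r q else z
  have hg : ∀ x, g (Quot.mk r (Equiv.swap p q x)) = g (Quot.mk r x) := by
    intro x
    rcases eq_or_ne x p with rfl | hx
    · simp [g]
    rcases eq_or_ne x q with rfl | hx'
    · simp [g]
    rw [Equiv.swap_apply_of_ne_of_ne hx hx']
  have hlift : ∀ x y, r' x y → g (Quot.mk r x) = g (Quot.mk r y) := by
    intro x y hxy
    rcases h x y hxy with h | h | h
    · rw [h]
    · rw [h, hg]
    · rw [← hg x, h, hg]
  let G : Option (Quot r') → Quot r := fun o =>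
    o.elim (Quot.mk r p) (Quot.lift (fun x => g (Quot.mk r x)) hlift)
  have hG : Function.Surjective G := by
    rintro ⟨x⟩
    by_cases hx : Quot.mk r x = Quot.mk r p
    · exact ⟨none, hx.symm⟩
    · exact ⟨some (Quot.mk r' x), by simp [G, g, hx]⟩
  have := Nat.card_le_card_of_surjective G hG
  rwa [Finite.card_option] at this

lemma jointClasses_swap_conj_le [DecidableEq ι] (α β : Equiv.Perm ι) (p q : ι) :
    jointClasses (Equiv.swap p q * α * Equiv.swap p q) β ≤ jointClasses α β + 1 := by
  refine card_quot_le_add_one p q fun x y hxy => ?_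
  rcases hxy with rfl | rfl
  · exact Or.inr (Or.inr (Quot.sound (Or.inl (by simp))))
  · exact Or.inl (Quot.sound (Or.inr rfl))

lemma jointClasses_swap_mul_le [DecidableEq ι] (α β : Equiv.Perm ι) (p q : ι) :
    jointClasses (Equiv.swap p q * α) (Equiv.swap p q * β) ≤ jointClasses α β + 1 := by
  refine card_quot_le_add_one p q fun x y hxy => Or.inr (Or.inl ?_)
  rcases hxy with rfl | rfl
  · exact Quot.sound (Or.inl (by simp))
  · exact Quot.sound (Or.inr (by simp))

lemma card_le_jointClasses_one : Nat.card ι ≤ jointClasses (1 : Equiv.Perm ι) 1 := by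
  refine Nat.card_le_card_of_surjective
    (Quot.lift id (by rintro x y (h | h) <;> simpa using h)) fun x => ⟨Quot.mk _ x, rfl⟩

lemma jointClasses_add_card_le {ε : ι → Bool} {S : Finset ι} (α : Equiv.Perm ι)
    {β : Equiv.Perm ι} (hβ : IsSignPairing ε S β) :
    jointClasses α β + (S.filter fun s => ¬ ε s = true).card ≤ Nat.card ι := by
  classical
  have := Fintype.ofFinite ι
  set T := S.filter fun s => ¬ ε s = true with hT
  have hsurj : Function.Surjective
      (fun x : {x // x ∉ T} => Quot.mk (fun x y => α x = y ∨ β x = y) x.1) := by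
    rintro ⟨x⟩
    by_cases hx : x ∈ T
    · obtain ⟨hxS, hxε⟩ := Finset.mem_filter.1 hx
      refine ⟨⟨β x, fun h => ?_⟩, 
        (Quot.sound (r := fun x y => α x = y ∨ β x = y) (Or.inr rfl)).symm⟩
      have h1 := (Finset.mem_filter.1 h).2
      have h2 := hβ.2.1 x hxS
      simp_all
    · exact ⟨⟨x, hx⟩, rfl⟩
  have h1 := Nat.card_le_card_of_surjective _ hsurj
  have h2 : Nat.card {x // x ∉ T} = Nat.card ι - T.card := by
    rw [Nat.card_eq_fintype_card, Nat.card_eq_fintype_card, Fintype.card_subtype_compl,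
      Fintype.card_coe]
  have h3 : T.card ≤ Nat.card ι := by
    rw [Nat.card_eq_fintype_card]; exact Finset.card_le_univ T
  rw [h2] at h1
  unfold jointClasses
  omega

end Pairings

section Expansion

variable {ι : Type*} [DecidableEq ι]

lemma fixInd_swap_conj {κ : Type*} (α : Equiv.Perm ι) (p q : ι) (a : ι → κ) :
    fixInd (Equiv.swap p q * α * Equiv.swap p q) (a ∘ Equiv.swap p q) = fixInd α a := by
  have : (a ∘ Equiv.swap p q) ∘ (Equiv.swap p q * α * Equiv.swap p q) = a ∘ Equiv.swap p q ↔
      a ∘ α = a := by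
    constructor
    · intro h
      funext x
      simpa using congrFun h (Equiv.swap p q x)
    · intro h
      funext x
      simpa using congrFun h (Equiv.swap p q x)
  exact fixInd_congr this

lemma fixInd_swap_mul {κ : Type*} [DecidableEq κ] (α : Equiv.Perm ι) {p q : ι} (hp : α p = p)
    (a : ι → κ) : fixInd (Equiv.swap p q * α) a = if a q = a p then fixInd α a else 0 := by
  by_cases h : a q = a p
  · have hsw : ∀ x, a (Equiv.swap p q x) = a x := by
      intro x
      rcases eq_or_ne x p with rfl | hx
      · simp [h]
      rcases eq_or_ne x q with rfl | hx'
      · simp [h]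
      rw [Equiv.swap_apply_of_ne_of_ne hx hx']
    have : a ∘ (Equiv.swap p q * α) = a ∘ α := by
      funext x
      simp [hsw]
    rw [if_pos h]
    exact fixInd_congr (by rw [this])
  · rw [if_neg h, fixInd, if_neg]
    intro h'
    have := congrFun h' p
    simp [hp] at this
    exact h this

variable [Fintype ι]

/-- The sum over all pairs `(α, β)` such that `a` is `α`-invariant and `b` is `β`-invariant. -/
noncomputable def pairSum {κ : Type*} (w : Equiv.Perm ι → Equiv.Perm ι → ℂ) (a b : ι → κ) : ℂ :=
  ∑ α, ∑ β, w α β * fixInd α a * fixInd β b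

lemma pairSum_swap_conj {κ : Type*} (w : Equiv.Perm ι → Equiv.Perm ι → ℂ) (p q : ι)
    (a b : ι → κ) :
    pairSum (fun α β => w (Equiv.swap p q * α * Equiv.swap p q) β) a b =
      pairSum w (a ∘ Equiv.swap p q) b := by
  unfold pairSum
  let e : Equiv.Perm ι ≃ Equiv.Perm ι :=
    (Equiv.mulLeft (Equiv.swap p q)).trans (Equiv.mulRight (Equiv.swap p q))
  refine Fintype.sum_equiv e _ _ fun α => Finset.sum_congr rfl fun β _ => ?_
  have he : e α = Equiv.swap p q * α * Equiv.swap p q := rfl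
  rw [he, fixInd_swap_conj]

lemma pairSum_swap_mul {κ : Type*} [DecidableEq κ] (w : Equiv.Perm ι → Equiv.Perm ι → ℂ)
    {p q : ι} (hw : ∀ α β, w α β ≠ 0 → α p = p ∧ β p = p) (a b : ι → κ) :
    pairSum (fun α β => w (Equiv.swap p q * α) (Equiv.swap p q * β)) a b =
      if a q = a p ∧ b q = b p then pairSum w a b else 0 := by
  have h1 : pairSum (fun α β => w (Equiv.swap p q * α) (Equiv.swap p q * β)) a b =
      ∑ α, ∑ β, w α β * fixInd (Equiv.swap p q * α) a * fixInd (Equiv.swap p q * β) b := by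
    unfold pairSum
    refine Fintype.sum_equiv (Equiv.mulLeft (Equiv.swap p q)) _ _ fun α =>
      Fintype.sum_equiv (Equiv.mulLeft (Equiv.swap p q)) _ _ fun β => ?_
    simp [← mul_assoc]
  have h2 : ∀ α β, w α β * fixInd (Equiv.swap p q * α) a * fixInd (Equiv.swap p q * β) b =
      if a q = a p ∧ b q = b p then w α β * fixInd α a * fixInd β b else 0 := by
    intro α β
    by_cases h0 : w α β = 0
    · simp [h0]
    obtain ⟨hα, hβ⟩ := hw α β h0
    rw [fixInd_swap_mul α hα, fixInd_swap_mul β hβ]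
    by_cases ha : a q = a p <;> by_cases hb : b q = b p <;> simp [ha, hb]
  rw [h1]
  simp only [h2]
  split_ifs
  · rfl
  · simp

/-- The coefficients `w` give an expansion of the mixed moments over `S` in pairs of pairings, up
to an error of order `N ^ (-J)`. -/
structure IsMomentExpansion (μ : (N : ℕ) → Measure (Matrix (Fin N) (Fin N) ℂ)) (ε : ι → Bool)
    (S : Finset ι) (J : ℕ) (w : ℕ → Equiv.Perm ι → Equiv.Perm ι → ℂ) (C : ℝ) : Prop where
  nonneg : 0 ≤ C
  support : ∀ N α β, w N α β ≠ 0 → IsSignPairing ε S α ∧ IsSignPairing ε S β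
  bound : ∀ N : ℕ, 1 ≤ N → ∀ α β,
    ‖w N α β‖ * (N : ℝ) ^ Nat.card ι ≤ C * (N : ℝ) ^ jointClasses α β
  error : ∀ N : ℕ, 1 ≤ N → ∀ a b : ι → Fin N,
    ‖mixedMoment (μ N) ε S a b - pairSum (w N) a b‖ * (N : ℝ) ^ J ≤ C
  diag : S = ∅ ∨ 1 ≤ J → ∀ N : ℕ, 1 ≤ N → ∀ α, IsSignPairing ε S α →
    ‖w N α α * (N : ℂ) ^ (S.filter fun s => ¬ ε s = true).card - 1‖ * (N : ℝ) ≤ C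

variable {μ : (N : ℕ) → Measure (Matrix (Fin N) (Fin N) ℂ)} {ε : ι → Bool} {S : Finset ι}

lemma isMomentExpansion_empty (hμ : ∀ N, IsHaarUnitary N (μ N)) (J : ℕ) :
    IsMomentExpansion μ ε ∅ J (fun _ α β => if α = 1 ∧ β = 1 then 1 else 0) 1 where
  nonneg := zero_le_one
  support N α β h := by
    have h1 : IsSignPairing ε ∅ (1 : Equiv.Perm ι) := ⟨fun _ => rfl, by simp, by simp⟩
    simp only [ne_eq, ite_eq_right_iff, one_ne_zero, imp_false, not_not] at h
    rw [h.1, h.2]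
    exact ⟨h1, h1⟩
  bound N hN α β := by
    have hN' : (1 : ℝ) ≤ N := by exact_mod_cast hN
    by_cases h : α = 1 ∧ β = 1
    · rw [if_pos h, h.1, h.2, norm_one]
      gcongr
      exact card_le_jointClasses_one
    · simp only [if_neg h, norm_zero, zero_mul]
      positivity
  error N hN a b := by
    have h : pairSum (fun α β : Equiv.Perm ι => if α = 1 ∧ β = 1 then (1 : ℂ) else 0) a b = 1 := by
      unfold pairSum
      rw [Fintype.sum_eq_single 1, Fintype.sum_eq_single 1]
      · simp [fixInd_one]
      · intro β hβ; simp [hβ]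
      · intro α hα; simp [hα]
    rw [h, (hμ N).mixedMoment_empty]
    simp
  diag _ N hN α hα := by
    have : α = 1 := Equiv.ext fun x => hα.2.2 x (by simp)
    simp [this]

lemma isMomentExpansion_of_forall_false (hμ : ∀ N, IsHaarUnitary N (μ N)) (hS : S.Nonempty)
    (hε : ∀ s ∈ S, ε s = false) (J : ℕ) :
    IsMomentExpansion μ ε S J (fun _ _ _ => 0) 0 where
  nonneg := le_rfl
  support N α β h := absurd rfl h
  bound N hN α β := by simp
  error N hN a b := by simp [(hμ N).mixedMoment_eq_zero ε hS hε, pairSum]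
  diag _ N hN α hα := by
    obtain ⟨s, hs⟩ := hS
    exact absurd ((hε _ (hα.mem hs)).trans (hε s hs).symm) (hα.2.1 s hs)

lemma isMomentExpansion_zero (hμ : ∀ N, IsHaarUnitary N (μ N)) (hS : S.Nonempty) :
    IsMomentExpansion μ ε S 0 (fun _ _ _ => 0) 1 where
  nonneg := zero_le_one
  support N α β h := absurd rfl h
  bound N hN α β := by simp
  error N hN a b := by simpa [pairSum] using (hμ N).norm_mixedMoment_le_one ε S a b
  diag h := absurd h (by simp [hS.ne_empty])

/-- The coefficients obtained by inserting expansions into the recursion for mixed moments. -/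
noncomputable def stepCoeff (ε : ι → Bool) (S : Finset ι) (s₀ : ι)
    (w : ℕ → Equiv.Perm ι → Equiv.Perm ι → ℂ)
    (w' : ι → ℕ → Equiv.Perm ι → Equiv.Perm ι → ℂ) : ℕ → Equiv.Perm ι → Equiv.Perm ι → ℂ :=
  fun N α β => (N : ℂ)⁻¹ *
    (-(∑ s ∈ (S.erase s₀).filter (fun s => ε s = true),
        w N (Equiv.swap s₀ s * α * Equiv.swap s₀ s) β) +
      ∑ s ∈ (S.erase s₀).filter (fun s => ¬ ε s = true),
        w' s N (Equiv.swap s₀ s * α) (Equiv.swap s₀ s * β))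

lemma mul_pairSum_stepCoeff {s₀ : ι} {w : ℕ → Equiv.Perm ι → Equiv.Perm ι → ℂ}
    {w' : ι → ℕ → Equiv.Perm ι → Equiv.Perm ι → ℂ} {N : ℕ} (hN : 1 ≤ N)
    (hw' : ∀ s α β, w' s N α β ≠ 0 → α s₀ = s₀ ∧ β s₀ = s₀) (a b : ι → Fin N) :
    N * pairSum (stepCoeff ε S s₀ w w' N) a b =
      -(∑ s ∈ (S.erase s₀).filter (fun s => ε s = true),
        pairSum (w N) (a ∘ Equiv.swap s₀ s) b) +
      ∑ s ∈ (S.erase s₀).filter (fun s => ¬ ε s = true),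
        if a s = a s₀ ∧ b s = b s₀ then pairSum (w' s N) a b else 0 := by
  have hN0 : (N : ℂ) ≠ 0 := by exact_mod_cast (by omega : N ≠ 0)
  simp only [← pairSum_swap_conj, ← pairSum_swap_mul (w' _ N) (hw' _)]
  simp only [pairSum, stepCoeff]
  rw [Finset.sum_comm (s := Finset.filter _ _), Finset.sum_comm (s := Finset.filter _ _),
    ← Finset.sum_neg_distrib, ← Finset.sum_add_distrib, Finset.mul_sum]
  refine Finset.sum_congr rfl fun α _ => ?_
  rw [Finset.sum_comm (s := Finset.filter _ _), Finset.sum_comm (s := Finset.filter _ _),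
    ← Finset.sum_neg_distrib, ← Finset.sum_add_distrib, Finset.mul_sum]
  refine Finset.sum_congr rfl fun β _ => ?_
  simp only [← Finset.sum_mul]
  field_simp

lemma IsMomentExpansion.step (hμ : ∀ N, IsHaarUnitary N (μ N)) {s₀ : ι} (hs₀ : s₀ ∈ S)
    (hε : ε s₀ = true) {J : ℕ} {w : ℕ → Equiv.Perm ι → Equiv.Perm ι → ℂ}
    {w' : ι → ℕ → Equiv.Perm ι → Equiv.Perm ι → ℂ} {C : ℝ} {C' : ι → ℝ}
    (hw : IsMomentExpansion μ ε S J w C)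
    (hw' : ∀ s, IsMomentExpansion μ ε ((S.erase s₀).erase s) (J + 1) (w' s) (C' s)) :
    IsMomentExpansion μ ε S (J + 1) (stepCoeff ε S s₀ w w')
      (∑ _s ∈ (S.erase s₀).filter (fun s => ε s = true), C +
        ∑ s ∈ (S.erase s₀).filter (fun s => ¬ ε s = true), C' s) where
  nonneg := add_nonneg (Finset.sum_nonneg fun _ _ => hw.nonneg)
    (Finset.sum_nonneg fun s _ => (hw' s).nonneg)
  support N α β h := by
    have h' := right_ne_zero_of_mul h
    rcases (not_and_or.1 fun hs => h' (by rw [hs.1, hs.2, neg_zero, add_zero]) :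
      ¬ (∑ s ∈ (S.erase s₀).filter (fun s => ε s = true),
          w N (Equiv.swap s₀ s * α * Equiv.swap s₀ s) β) = 0 ∨
      ¬ (∑ s ∈ (S.erase s₀).filter (fun s => ¬ ε s = true),
          w' s N (Equiv.swap s₀ s * α) (Equiv.swap s₀ s * β)) = 0) with h0 | h0
    · obtain ⟨s, hs, hsw⟩ := Finset.exists_ne_zero_of_sum_ne_zero h0
      simp only [Finset.mem_filter, Finset.mem_erase] at hs
      obtain ⟨h1, h2⟩ := hw.support N _ _ hsw
      have h3 := h1.swap_conj hs₀ hs.1.2 (hε.trans hs.2.symm)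
      refine ⟨?_, h2⟩
      convert h3 using 1
      simp [mul_assoc]
    · obtain ⟨s, hs, hsw⟩ := Finset.exists_ne_zero_of_sum_ne_zero h0
      simp only [Finset.mem_filter, Finset.mem_erase] at hs
      obtain ⟨h1, h2⟩ := (hw' s).support N _ _ hsw
      have h3 : ε s₀ ≠ ε s := fun h => hs.2 (h ▸ hε)
      have h4 := IsSignPairing.swap_mul hs₀ hs.1.2 h3 h1
      have h5 := IsSignPairing.swap_mul hs₀ hs.1.2 h3 h2
      rw [← mul_assoc, Equiv.swap_mul_self, one_mul] at h4 h5
      exact ⟨h4, h5⟩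
  bound N hN α β := by
    have hN' : (1 : ℝ) ≤ N := by exact_mod_cast hN
    have hN0 : (0 : ℝ) < N := by linarith
    have hle : ‖stepCoeff ε S s₀ w w' N α β‖ * N ≤
        ∑ s ∈ (S.erase s₀).filter (fun s => ε s = true),
          ‖w N (Equiv.swap s₀ s * α * Equiv.swap s₀ s) β‖ +
        ∑ s ∈ (S.erase s₀).filter (fun s => ¬ ε s = true),
          ‖w' s N (Equiv.swap s₀ s * α) (Equiv.swap s₀ s * β)‖ := by
      unfold stepCoeff
      rw [norm_mul, norm_inv, Complex.norm_natCast, mul_comm, mul_inv_cancel_left₀ hN0.ne']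
      refine (norm_add_le _ _).trans (add_le_add ?_ (norm_sum_le _ _))
      rw [norm_neg]
      exact norm_sum_le _ _
    have hmul : ‖stepCoeff ε S s₀ w w' N α β‖ * (N : ℝ) ^ Nat.card ι * N ≤
        (∑ _s ∈ (S.erase s₀).filter (fun s => ε s = true), C +
          ∑ s ∈ (S.erase s₀).filter (fun s => ¬ ε s = true), C' s) *
          (N : ℝ) ^ jointClasses α β * N := by
      calc _ = ‖stepCoeff ε S s₀ w w' N α β‖ * N * (N : ℝ) ^ Nat.card ι := by ring
        _ ≤ _ := mul_le_mul_of_nonneg_right hle (by positivity)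
        _ ≤ _ := by
          rw [mul_assoc, ← pow_succ, add_mul, add_mul, Finset.sum_mul, Finset.sum_mul,
            Finset.sum_mul, Finset.sum_mul]
          refine add_le_add (Finset.sum_le_sum fun s _ => ?_) (Finset.sum_le_sum fun s _ => ?_)
          · refine (hw.bound N hN _ _).trans ?_
            have := hw.nonneg
            have := jointClasses_swap_conj_le α β s₀ s
            gcongr
          · refine ((hw' s).bound N hN _ _).trans ?_
            have := (hw' s).nonneg
            have := jointClasses_swap_mul_le α β s₀ s
            gcongr
    exact le_of_mul_le_mul_right hmul hN0
  error N hN a b := by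
    have hN' : (1 : ℝ) ≤ N := by exact_mod_cast hN
    have hrec := (hμ N).mixedMoment_recursion ε hs₀ hε a b
    have hpair := mul_pairSum_stepCoeff (ε := ε) (S := S) (w := w) hN
      (fun s α β h => ⟨((hw' s).support N α β h).1.2.2 s₀ (by simp),
        ((hw' s).support N α β h).2.2.2 s₀ (by simp)⟩) a b
    have heq : N * (mixedMoment (μ N) ε S a b - pairSum (stepCoeff ε S s₀ w w' N) a b) =
        -(∑ s ∈ (S.erase s₀).filter (fun s => ε s = true),
          (mixedMoment (μ N) ε S (a ∘ Equiv.swap s₀ s) b -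
            pairSum (w N) (a ∘ Equiv.swap s₀ s) b)) +
        ∑ s ∈ (S.erase s₀).filter (fun s => ¬ ε s = true),
          if a s = a s₀ ∧ b s = b s₀ then
            mixedMoment (μ N) ε ((S.erase s₀).erase s) a b - pairSum (w' s N) a b else 0 := by
      have hite : ∀ s, (if a s = a s₀ ∧ b s = b s₀ then
            mixedMoment (μ N) ε ((S.erase s₀).erase s) a b - pairSum (w' s N) a b else 0) =
          (if a s = a s₀ ∧ b s = b s₀ then
            mixedMoment (μ N) ε ((S.erase s₀).erase s) a b else 0) -
          if a s = a s₀ ∧ b s = b s₀ then pairSum (w' s N) a b else 0 := by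
        intro s; split_ifs <;> simp
      simp only [hite, Finset.sum_sub_distrib]
      linear_combination hrec - hpair
    calc ‖mixedMoment (μ N) ε S a b - pairSum (stepCoeff ε S s₀ w w' N) a b‖ * (N : ℝ) ^ (J + 1)
        = ‖N * (mixedMoment (μ N) ε S a b - pairSum (stepCoeff ε S s₀ w w' N) a b)‖ *
            (N : ℝ) ^ J := by
          rw [norm_mul, Complex.norm_natCast]; ring
      _ ≤ (∑ s ∈ (S.erase s₀).filter (fun s => ε s = true),
            ‖mixedMoment (μ N) ε S (a ∘ Equiv.swap s₀ s) b -
              pairSum (w N) (a ∘ Equiv.swap s₀ s) b‖ +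
          ∑ s ∈ (S.erase s₀).filter (fun s => ¬ ε s = true),
            ‖mixedMoment (μ N) ε ((S.erase s₀).erase s) a b - pairSum (w' s N) a b‖) *
            (N : ℝ) ^ J := by
          refine mul_le_mul_of_nonneg_right ?_ (by positivity)
          rw [heq]
          refine (norm_add_le _ _).trans (add_le_add ?_ ?_)
          · rw [norm_neg]
            exact norm_sum_le _ _
          · refine (norm_sum_le _ _).trans (Finset.sum_le_sum fun s _ => ?_)
            split_ifs
            · exact le_rfl
            · simp
      _ ≤ _ := by
          rw [add_mul, Finset.sum_mul, Finset.sum_mul]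
          refine add_le_add (Finset.sum_le_sum fun s _ => hw.error N hN _ _)
            (Finset.sum_le_sum fun s _ => ?_)
          refine le_trans ?_ ((hw' s).error N hN a b)
          gcongr
          omega
  diag _ N hN α hα := by
    have hN' : (1 : ℝ) ≤ N := by exact_mod_cast hN
    have hN0 : (0 : ℝ) < N := by linarith
    have hNC : (N : ℂ) ≠ 0 := by exact_mod_cast hN0.ne'
    have hα₀ : α s₀ ∈ (S.erase s₀).filter (fun s => ¬ ε s = true) := by
      have h1 := hα.2.1 s₀ hs₀
      have h2 : α s₀ ≠ s₀ := fun h => h1 (congrArg ε h)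
      simp only [Finset.mem_filter, Finset.mem_erase]
      exact ⟨⟨h2, hα.mem hs₀⟩, fun h => h1 (h.trans hε.symm)⟩
    have hsingle : ∑ s ∈ (S.erase s₀).filter (fun s => ¬ ε s = true),
        w' s N (Equiv.swap s₀ s * α) (Equiv.swap s₀ s * α) =
        w' (α s₀) N (Equiv.swap s₀ (α s₀) * α) (Equiv.swap s₀ (α s₀) * α) := by
      refine Finset.sum_eq_single_of_mem _ hα₀ fun s _ hne => ?_
      by_contra h0
      have h1 := ((hw' s).support N _ _ h0).1.2.2 s₀ (by simp)
      rw [Equiv.Perm.mul_apply, Equiv.swap_apply_eq_iff, Equiv.swap_apply_left] at h1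
      exact hne h1.symm
    have hcard : (S.filter fun s => ¬ ε s = true).card =
        (((S.erase s₀).erase (α s₀)).filter fun s => ¬ ε s = true).card + 1 := by
      rw [← Finset.card_erase_add_one (Finset.mem_filter.2
        ⟨(Finset.mem_erase.1 (Finset.mem_filter.1 hα₀).1).2, (Finset.mem_filter.1 hα₀).2⟩)]
      congr 2
      ext s
      simp only [Finset.mem_erase, Finset.mem_filter]
      constructor
      · rintro ⟨h1, h2, h3⟩
        exact ⟨⟨h1, fun h => h3 (h ▸ hε), h2⟩, h3⟩
      · rintro ⟨⟨h1, -, h2⟩, h3⟩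
        exact ⟨h1, h2, h3⟩
    set n := (((S.erase s₀).erase (α s₀)).filter fun s => ¬ ε s = true).card with hn
    have heq : (stepCoeff ε S s₀ w w' N α α * (N : ℂ) ^ (n + 1) - 1) * N =
        -(∑ s ∈ (S.erase s₀).filter (fun s => ε s = true),
          w N (Equiv.swap s₀ s * α * Equiv.swap s₀ s) α * (N : ℂ) ^ (n + 1)) +
        (w' (α s₀) N (Equiv.swap s₀ (α s₀) * α) (Equiv.swap s₀ (α s₀) * α) * (N : ℂ) ^ n - 1) *
          N := by
      unfold stepCoeff
      rw [hsingle, ← Finset.sum_mul]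
      field_simp
      ring
    rw [hcard]
    calc _ = ‖(stepCoeff ε S s₀ w w' N α α * (N : ℂ) ^ (n + 1) - 1) * N‖ := by
          rw [norm_mul, Complex.norm_natCast]
      _ ≤ ∑ s ∈ (S.erase s₀).filter (fun s => ε s = true),
            ‖w N (Equiv.swap s₀ s * α * Equiv.swap s₀ s) α * (N : ℂ) ^ (n + 1)‖ + C' (α s₀) := by
          rw [heq]
          refine (norm_add_le _ _).trans (add_le_add ?_ ?_)
          · rw [norm_neg]
            exact norm_sum_le _ _
          · rw [norm_mul, Complex.norm_natCast]
            exact (hw' (α s₀)).diag (Or.inr (by omega)) N hN _ hα.erase_pair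
      _ ≤ _ := by
          refine add_le_add (Finset.sum_le_sum fun s _ => ?_)
            (Finset.single_le_sum (f := C') (fun s _ => (hw' s).nonneg) hα₀)
          rw [norm_mul, norm_pow, Complex.norm_natCast]
          have h1 := jointClasses_add_card_le (Equiv.swap s₀ s * α * Equiv.swap s₀ s) hα
          rw [hcard] at h1
          have h2 := hw.bound N hN (Equiv.swap s₀ s * α * Equiv.swap s₀ s) α
          set j := jointClasses (Equiv.swap s₀ s * α * Equiv.swap s₀ s) α
          have h3 : (0 : ℝ) < (N : ℝ) ^ j := by positivity
          refine le_of_mul_le_mul_right (le_trans ?_ h2) h3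
          rw [mul_assoc, ← pow_add]
          gcongr
          omega

lemma exists_isMomentExpansion (hμ : ∀ N, IsHaarUnitary N (μ N)) (ε : ι → Bool) (S : Finset ι) :
    ∀ J, ∃ w C, IsMomentExpansion μ ε S J w C := by
  induction S using Finset.strongInduction with
  | H S ih =>
    intro J
    rcases S.eq_empty_or_nonempty with rfl | hS
    · exact ⟨_, _, isMomentExpansion_empty hμ J⟩
    by_cases hε : ∃ s₀ ∈ S, ε s₀ = true
    · obtain ⟨s₀, hs₀, hε⟩ := hε
      induction J with
      | zero => exact ⟨_, _, isMomentExpansion_zero hμ hS⟩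
      | succ J ihJ =>
        obtain ⟨w, C, hw⟩ := ihJ
        have hsub : ∀ s, (S.erase s₀).erase s ⊂ S := fun s =>
          (Finset.erase_subset _ _).trans_ssubset (Finset.erase_ssubset hs₀)
        choose w' C' hw' using fun s => ih _ (hsub s) (J + 1)
        exact ⟨_, _, hw.step hμ hs₀ hε hw'⟩
    · push Not at hε
      exact ⟨_, _, isMomentExpansion_of_forall_false hμ hS (by simpa using hε) J⟩

end Expansion

section Reveal

variable {ι κ : Type*} [DecidableEq κ]

/-- The values taken at `v j` by the elements of `X` that agree with `x` at `v 0, …, v (j - 1)`. -/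
def revealValues (X : Finset (ι → κ)) (v : ℕ → ι) (x : ι → κ) (j : ℕ) : Finset κ :=
  (X.filter fun y => ∀ t < j, y (v t) = x (v t)).image fun y => y (v j)

lemma card_image_prefix_succ_le (X : Finset (ι → κ)) (v : ℕ → ι) (j : ℕ) {c : ℝ}
    (h : ∀ x ∈ X, ((revealValues X v x j).card : ℝ) ≤ c) :
    ((X.image fun x (t : Fin (j + 1)) => x (v t)).card : ℝ) ≤
      c * (X.image fun x (t : Fin j) => x (v t)).card := by
  have hmaps : ∀ z ∈ X.image (fun x (t : Fin (j + 1)) => x (v t)),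
      (fun t : Fin j => z t.castSucc) ∈ X.image fun x (t : Fin j) => x (v t) := by
    intro z hz
    obtain ⟨x, hx, rfl⟩ := Finset.mem_image.1 hz
    exact Finset.mem_image.2 ⟨x, hx, by funext t; simp⟩
  rw [Finset.card_eq_sum_card_fiberwise hmaps, Nat.cast_sum, mul_comm, ← nsmul_eq_mul]
  refine Finset.sum_le_card_nsmul _ _ _ fun z hz => ?_
  obtain ⟨x, hx, rfl⟩ := Finset.mem_image.1 hz
  refine le_trans ?_ (h x hx)
  rw [Nat.cast_le]
  refine Finset.card_le_card_of_injOn (fun z => z (Fin.last j)) ?_ ?_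
  · intro z hz
    obtain ⟨hz, hzx⟩ := Finset.mem_filter.1 hz
    obtain ⟨y, hy, rfl⟩ := Finset.mem_image.1 hz
    refine Finset.mem_image.2 ⟨y, Finset.mem_filter.2 ⟨hy, fun t ht => ?_⟩, by simp⟩
    simpa using congrFun hzx ⟨t, ht⟩
  · intro z hz z' hz' heq
    have h1 := (Finset.mem_filter.1 hz).2
    have h2 := (Finset.mem_filter.1 hz').2
    funext t
    refine Fin.lastCases heq (fun t => ?_) t
    exact congrFun (h1.trans h2.symm) t

lemma card_le_prod_mul_card_prefix (X : Finset (ι → κ)) (v : ℕ → ι) {k n : ℕ} (hkn : k ≤ n)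
    {c : ℕ → ℝ} (hc : ∀ j, 0 ≤ c j)
    (h : ∀ j, k ≤ j → j < n → ∀ x ∈ X, ((revealValues X v x j).card : ℝ) ≤ c j)
    (hv : ∀ s, ∃ t < n, v t = s) :
    (X.card : ℝ) ≤
      (∏ j ∈ Finset.Ico k n, c j) * (X.image fun x (t : Fin k) => x (v t)).card := by
  have hpre : ∀ l, k ≤ l → l ≤ n → ((X.image fun x (t : Fin l) => x (v t)).card : ℝ) ≤
      (∏ j ∈ Finset.Ico k l, c j) * (X.image fun x (t : Fin k) => x (v t)).card := by
    intro l hkl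
    induction l, hkl using Nat.le_induction with
    | base => simp
    | succ l hkl ih =>
      intro hl
      rw [Finset.prod_Ico_succ_top hkl, mul_comm (∏ j ∈ _, _), mul_assoc]
      exact (card_image_prefix_succ_le X v l (h l hkl hl)).trans
        (mul_le_mul_of_nonneg_left (ih (by omega)) (hc l))
  refine le_trans (le_of_eq ?_) (hpre n hkn le_rfl)
  rw [Finset.card_image_of_injective]
  intro x y hxy
  funext s
  obtain ⟨t, ht, rfl⟩ := hv s
  exact congrFun hxy ⟨t, ht⟩

end Reveal

section Tour

variable {m : ℕ} [NeZero m]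

/-- An enumeration `p` of the edges of the `m`-cycle, in which `p j` joins `v j` and `v (j + 1)`;
`ord s` is the time at which the edge `s` is visited. -/
structure IsTour (v p : ℕ → Fin m) (ord : Fin m → ℕ) : Prop where
  edge : ∀ j, (v j = p j ∧ v (j + 1) = p j + 1) ∨ (v j = p j + 1 ∧ v (j + 1) = p j)
  ord_lt : ∀ s, ord s < m
  left_inv : ∀ s, p (ord s) = s

namespace IsTour

variable {v p : ℕ → Fin m} {ord : Fin m → ℕ}

lemma injective (h : IsTour v p ord) : Function.Injective ord :=
  Function.LeftInverse.injective h.left_inv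

lemma exists_ord_eq (h : IsTour v p ord) {j : ℕ} (hj : j < m) : ∃ s, ord s = j := by
  have hinj : Function.Injective fun s => (⟨ord s, h.ord_lt s⟩ : Fin m) := fun s t hst =>
    h.injective (congrArg Fin.val hst)
  obtain ⟨s, hs⟩ := Finite.injective_iff_surjective.1 hinj ⟨j, hj⟩
  exact ⟨s, congrArg Fin.val hs⟩

lemma exists_vertex (h : IsTour v p ord) (s : Fin m) : ∃ t < m + 1, v t = s := by
  have hlt := h.ord_lt s
  rcases h.edge (ord s) with ⟨h1, -⟩ | ⟨-, h2⟩
  · exact ⟨ord s, by omega, by rw [h1, h.left_inv]⟩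
  · exact ⟨ord s + 1, by omega, by rw [h2, h.left_inv]⟩

lemma agree (h : IsTour v p ord) {κ : Type*} {x y : Fin m → κ} {j : ℕ}
    (hxy : ∀ t < j + 1, y (v t) = x (v t)) {s : Fin m} (hs : ord s < j) :
    y s = x s ∧ y (s + 1) = x (s + 1) := by
  have h1 := hxy (ord s) (by omega)
  have h2 := hxy (ord s + 1) (by omega)
  rcases h.edge (ord s) with ⟨e1, e2⟩ | ⟨e1, e2⟩
  · rw [e1, h.left_inv] at h1
    rw [e2, h.left_inv] at h2
    exact ⟨h1, h2⟩
  · rw [e1, h.left_inv] at h1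
    rw [e2, h.left_inv] at h2
    exact ⟨h2, h1⟩

lemma prod_Ico (h : IsTour v p ord) (k : ℕ) (f : ℕ → ℝ) :
    ∏ j ∈ Finset.Ico k m, f j = ∏ s with k ≤ ord s, f (ord s) := by
  symm
  refine Finset.prod_bij (fun s _ => ord s)
    (fun s hs => Finset.mem_Ico.2 ⟨(Finset.mem_filter.1 hs).2, h.ord_lt s⟩)
    (fun s _ t _ hst => h.injective hst) (fun j hj => ?_) fun _ _ => rfl
  obtain ⟨hk, hj⟩ := Finset.mem_Ico.1 hj
  obtain ⟨s, rfl⟩ := h.exists_ord_eq hj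
  exact ⟨s, Finset.mem_filter.2 ⟨Finset.mem_univ _, hk⟩, rfl⟩

end IsTour

lemma val_fin_add_one (x : Fin m) :
    ((x + 1 : Fin m) : ℕ) = if (x : ℕ) + 1 = m then 0 else (x : ℕ) + 1 := by
  have := x.2
  simp only [Fin.val_add, Fin.val_one', Nat.add_mod_mod]
  split_ifs with h
  · rw [h, Nat.mod_self]
  · exact Nat.mod_eq_of_lt (by omega)

lemma ofNat_forward_succ (r : Fin m) (j : ℕ) :
    Fin.ofNat m (r + (j + 1)) = Fin.ofNat m (r + j) + 1 :=
  Fin.ext (by simp [Fin.val_add, ← add_assoc])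

lemma ofNat_backward_succ (r : Fin m) (j : ℕ) :
    Fin.ofNat m (r + j * (m - 1)) = Fin.ofNat m (r + (j + 1) * (m - 1)) + 1 := by
  have hm : 1 ≤ m := NeZero.one_le
  have : (r : ℕ) + (j + 1) * (m - 1) + 1 = r + j * (m - 1) + m := by
    rw [add_mul]; omega
  exact Fin.ext (by simp [Fin.val_add, this])

lemma isTour_forward (r : Fin m) :
    IsTour (fun j => Fin.ofNat m (r + j)) (fun j => Fin.ofNat m (r + j))
      (fun s => if r ≤ s then s - r else s + m - r) where
  edge j := Or.inl ⟨rfl, ofNat_forward_succ r j⟩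
  ord_lt s := by
    have := s.2; have := r.2
    split_ifs with h <;> rw [Fin.le_def] at h <;> omega
  left_inv s := by
    have := s.2; have := r.2
    apply Fin.ext
    simp only [Fin.val_ofNat]
    split_ifs with h <;> rw [Fin.le_def] at h
    · rw [Nat.add_sub_cancel' h, Nat.mod_eq_of_lt s.2]
    · rw [Nat.add_sub_cancel' (by omega), Nat.add_mod_right, Nat.mod_eq_of_lt s.2]

lemma isTour_backward (r : Fin m) :
    IsTour (fun j => Fin.ofNat m (r + j * (m - 1))) (fun j => Fin.ofNat m (r + (j + 1) * (m - 1)))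
      (fun s => if s < r then r - 1 - s else r + m - 1 - s) where
  edge j := Or.inr ⟨ofNat_backward_succ r j, rfl⟩
  ord_lt s := by
    have := s.2; have := r.2
    split_ifs with h <;> rw [Fin.lt_def] at h <;> omega
  left_inv s := by
    have hs := s.2; have hr := r.2
    apply Fin.ext
    simp only [Fin.val_ofNat]
    obtain ⟨k, hk⟩ : ∃ k, m = k + 1 := ⟨m - 1, by omega⟩
    split_ifs with h <;> rw [Fin.lt_def] at h
    · obtain ⟨d, hd⟩ : ∃ d, (r : ℕ) = s + d + 1 := ⟨r - s - 1, by omega⟩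
      have : (r : ℕ) + (r - 1 - s + 1) * (m - 1) = s + m * (d + 1) := by
        have hmul : m * (d + 1) = (k + 1) * (d + 1) := congrArg (· * (d + 1)) hk
        rw [show (r : ℕ) - 1 - s + 1 = d + 1 by omega, hd, show m - 1 = k by omega, hmul]
        ring
      rw [this, Nat.add_mul_mod_self_left, Nat.mod_eq_of_lt hs]
    · obtain ⟨d, hd⟩ : ∃ d, (r : ℕ) + m - 1 = s + d := ⟨r + m - 1 - s, by omega⟩
      have : (r : ℕ) + (r + m - 1 - s + 1) * (m - 1) = s + m * d := by
        have hmul : m * d = (k + 1) * d := congrArg (· * d) hk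
        rw [show (r : ℕ) + m - 1 - s + 1 = d + 1 by omega, show m - 1 = k by omega, hmul,
          add_mul, add_mul, mul_comm k d]
        omega
      rw [this, Nat.add_mul_mod_self_left, Nat.mod_eq_of_lt hs]

lemma isTour_val :
    IsTour (fun j => Fin.ofNat m j) (fun j => Fin.ofNat m j) (fun s : Fin m => (s : ℕ)) := by
  simpa using isTour_forward (0 : Fin m)

lemma exists_isTour_forward {e x y : Fin m}
    (h : (e < x ∧ x < y) ∨ (x < y ∧ y < e) ∨ (y < e ∧ e < x)) :
    ∃ v p ord, IsTour (m := m) v p ord ∧ ord y < ord e ∧ ord e < ord x ∧ v (ord e) = e ∧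
      v (ord e + 1) = e + 1 := by
  have ht := isTour_forward (x + 1)
  have he := ht.left_inv e
  refine ⟨_, _, _, ht, ?_, ?_, he, ?_⟩
  · simp only [Fin.le_def, Fin.lt_def, val_fin_add_one] at h ⊢
    split_ifs <;> omega
  · simp only [Fin.le_def, Fin.lt_def, val_fin_add_one] at h ⊢
    split_ifs <;> omega
  · exact (ofNat_forward_succ _ _).trans (congrArg (· + 1) he)

lemma exists_isTour_backward {e x y : Fin m}
    (h : (e < x ∧ x < y) ∨ (x < y ∧ y < e) ∨ (y < e ∧ e < x)) :
    ∃ v p ord, IsTour (m := m) v p ord ∧ ord x < ord e ∧ ord e < ord y ∧ v (ord e) = e + 1 ∧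
      v (ord e + 1) = e := by
  have ht := isTour_backward y
  have he := ht.left_inv e
  refine ⟨_, _, _, ht, ?_, ?_, ?_, he⟩
  · simp only [Fin.lt_def] at h ⊢
    split_ifs <;> omega
  · simp only [Fin.lt_def] at h ⊢
    split_ifs <;> omega
  · exact (ofNat_backward_succ _ _).trans (congrArg (· + 1) he)

lemma exists_isTour_start (e : Fin m) :
    ∃ v p ord, IsTour (m := m) v p ord ∧ ord e = 0 ∧ v 0 = e ∧ v 1 = e + 1 := by
  have ht := isTour_forward e
  have he := ht.left_inv e
  simp only [le_refl, if_true, tsub_self] at he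
  exact ⟨_, _, _, ht, by simp, he, (ofNat_forward_succ e 0).trans (congrArg (· + 1) he)⟩

end Tour

section Solutions

variable {m N : ℕ}

/-- The points whose images under `α` and `β` both come earlier in the order `ord`. -/
def closers (ord : Fin m → ℕ) (α β : Equiv.Perm (Fin m)) : Finset (Fin m) :=
  Finset.univ.filter fun s => ord (α s) < ord s ∧ ord (β s) < ord s

lemma jointClasses_le_card_closers {ord : Fin m → ℕ} (hord : Function.Injective ord)
    {α β : Equiv.Perm (Fin m)} (hα : ∀ s, α s ≠ s) (hβ : ∀ s, β s ≠ s) :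
    jointClasses α β ≤ (closers ord α β).card := by
  classical
  have hsurj : Function.Surjective (fun x : closers ord α β =>
      Quot.mk (fun x y => α x = y ∨ β x = y) x.1) := by
    rintro ⟨x⟩
    obtain ⟨s, hs, hmax⟩ := Finset.exists_max_image (Finset.univ.filter fun s =>
      Quot.mk (fun x y => α x = y ∨ β x = y) s = Quot.mk _ x) ord ⟨x, by simp⟩
    simp only [Finset.mem_filter, Finset.mem_univ, true_and] at hs hmax
    refine ⟨⟨s, Finset.mem_filter.2 ⟨Finset.mem_univ _, ?_, ?_⟩⟩, hs⟩
    · refine lt_of_le_of_ne (hmax _ ?_) fun h => hα s (hord h)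
      exact (Quot.sound (r := fun x y => α x = y ∨ β x = y) (Or.inl rfl)).symm.trans hs
    · refine lt_of_le_of_ne (hmax _ ?_) fun h => hβ s (hord h)
      exact (Quot.sound (r := fun x y => α x = y ∨ β x = y) (Or.inr rfl)).symm.trans hs
  have := Nat.card_le_card_of_surjective _ hsurj
  rwa [Nat.card_eq_fintype_card (α := closers ord α β), Fintype.card_coe] at this

variable [NeZero m]

/-- The index pair of the `s`-th factor in a product of matrices and conjugate transposes. -/
def edgePair {κ : Type*} (ε : Fin m → Bool) (s : Fin m) (i : Fin m → κ) : κ × κ :=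
  if ε s then (i s, i (s + 1)) else (i (s + 1), i s)

/-- The cyclic index sequences whose permuted row indices are `α`-invariant and whose permuted
column indices are `β`-invariant. -/
def pairingSolutions (σ : Equiv.Perm (Fin N × Fin N)) (ε : Fin m → Bool)
    (α β : Equiv.Perm (Fin m)) : Finset (Fin m → Fin N) :=
  Finset.univ.filter fun i => ∀ s, (σ (edgePair ε (α s) i)).1 = (σ (edgePair ε s i)).1 ∧
    (σ (edgePair ε (β s) i)).2 = (σ (edgePair ε s i)).2

lemma edgePair_eq_iff {κ : Type*} {ε : Fin m → Bool} {s : Fin m} {i i' : Fin m → κ} :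
    edgePair ε s i = edgePair ε s i' ↔ i s = i' s ∧ i (s + 1) = i' (s + 1) := by
  unfold edgePair
  split_ifs <;> simp [Prod.ext_iff, and_comm]

variable {σ : Equiv.Perm (Fin N × Fin N)} {ε : Fin m → Bool} {α β : Equiv.Perm (Fin m)}
  {X : Finset (Fin m → Fin N)} {v p : ℕ → Fin m} {ord : Fin m → ℕ}

lemma IsTour.edgePair_eq (h : IsTour v p ord) {κ : Type*} {x y : Fin m → κ} {j : ℕ}
    (hxy : ∀ t < j + 1, y (v t) = x (v t)) {s : Fin m} (hs : ord s < j) :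
    edgePair ε s y = edgePair ε s x :=
  edgePair_eq_iff.2 (h.agree hxy hs)

lemma IsTour.card_revealValues_le_one (h : IsTour v p ord) (hX : X ⊆ pairingSolutions σ ε α β)
    {s : Fin m} (hs : s ∈ closers ord α β) {x : Fin m → Fin N} (hx : x ∈ X) :
    (revealValues X v x (ord s + 1)).card ≤ 1 := by
  refine (Finset.card_le_card (t := {x (v (ord s + 1))}) fun z hz => ?_).trans (by simp)
  obtain ⟨y, hy, rfl⟩ := Finset.mem_image.1 hz
  obtain ⟨hy, hyx⟩ := Finset.mem_filter.1 hy
  obtain ⟨-, h1, h2⟩ := Finset.mem_filter.1 hs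
  have hxs := (Finset.mem_filter.1 (hX hx)).2 s
  have hys := (Finset.mem_filter.1 (hX hy)).2 s
  have he : edgePair ε s y = edgePair ε s x := by
    apply σ.injective
    refine Prod.ext ?_ ?_
    · rw [← hys.1, ← hxs.1, h.edgePair_eq hyx h1]
    · rw [← hys.2, ← hxs.2, h.edgePair_eq hyx h2]
  obtain ⟨e1, e2⟩ := edgePair_eq_iff.1 he
  rw [Finset.mem_singleton]
  rcases h.edge (ord s) with ⟨-, e⟩ | ⟨-, e⟩ <;> rw [e, h.left_inv] <;> assumption

lemma IsTour.card_le (h : IsTour v p ord) (hX : X ⊆ pairingSolutions σ ε α β)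
    {k : ℕ} (hk : k ≤ m) {g : Fin m → ℝ} (hg : ∀ s, 0 ≤ g s)
    (hgX : ∀ s ∉ closers ord α β, k ≤ ord s → ∀ x ∈ X,
      ((revealValues X v x (ord s + 1)).card : ℝ) ≤ g s) :
    (X.card : ℝ) ≤ (∏ s with k ≤ ord s, if s ∈ closers ord α β then 1 else g s) *
      (X.image fun x (t : Fin (k + 1)) => x (v t)).card := by
  have hc : ∀ s, (0 : ℝ) ≤ if s ∈ closers ord α β then 1 else g s := fun s => by
    split_ifs
    · exact zero_le_one
    · exact hg s
  have := card_le_prod_mul_card_prefix X v (k := k + 1) (n := m + 1) (by omega)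
    (c := fun j => if p (j - 1) ∈ closers ord α β then 1 else g (p (j - 1))) (fun j => hc _)
    (fun j hkj hj x hx => ?_) h.exists_vertex
  · rw [← Finset.prod_Ico_add'] at this
    simpa only [h.prod_Ico, Nat.add_sub_cancel, h.left_inv] using this
  · obtain ⟨s, hs⟩ := h.exists_ord_eq (j := j - 1) (by omega)
    obtain rfl : j = ord s + 1 := by omega
    simp only [Nat.add_sub_cancel, h.left_inv]
    split_ifs with hcl
    · exact_mod_cast h.card_revealValues_le_one hX hcl hx
    · exact hgX s hcl (by omega) x hx

end Solutions

section DistinctPairings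

lemma prod_ite_mem_one_mul_pow {ι : Type*} [Fintype ι] [DecidableEq ι] (S : Finset ι) (c : ℝ)
    {e : ι} (he : e ∉ S) (d : ℝ) :
    (∏ s, if s ∈ S then 1 else if s = e then d * c else c) * c ^ S.card =
      d * c ^ Fintype.card ι := by
  have h1 : c ^ S.card = ∏ s, if s ∈ S then c else 1 := by simp
  have h2 : d * c ^ Fintype.card ι = ∏ s, (if s = e then d else 1) * c := by
    rw [Finset.prod_mul_distrib]
    simp
  rw [h1, h2, ← Finset.prod_mul_distrib]
  refine Finset.prod_congr rfl fun s _ => ?_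
  by_cases hs : s ∈ S
  · have : s ≠ e := fun h => he (h ▸ hs)
    simp [hs, this]
  · by_cases hse : s = e <;> simp [hs, hse, he]

/-- The number of entries in row `i` that have the same permuted row index as `(i, j)`. -/
def rowCount {N : ℕ} (σ : Equiv.Perm (Fin N × Fin N)) (i j : Fin N) : ℕ :=
  (Finset.univ.filter fun l => (σ (i, l)).1 = (σ (i, j)).1).card

/-- The number of entries in column `j` that have the same permuted column index as `(i, j)`. -/
def colCount {N : ℕ} (σ : Equiv.Perm (Fin N × Fin N)) (i j : Fin N) : ℕ :=
  (Finset.univ.filter fun k => (σ (k, j)).2 = (σ (i, j)).2).card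

/-- The number of quadruples `(i, j, k, l)` such that `(i, l)` has the permuted row index and
`(k, j)` the permuted column index of `(i, j)`. -/
def rowColCount {N : ℕ} (σ : Equiv.Perm (Fin N × Fin N)) : ℕ :=
  (Finset.univ.filter fun x : Fin N × Fin N × Fin N × Fin N =>
    σ (x.1, x.2.1) = ((σ (x.1, x.2.2.2)).1, (σ (x.2.2.1, x.2.1)).2)).card

lemma Zcnt_eq {N : ℕ} (σ : Equiv.Perm (Fin N × Fin N)) :
    Zcnt N σ = rowColCount σ + rowColCount (σ.trans (Equiv.prodComm _ _)) := by
  unfold Zcnt rowColCount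
  congr 2
  ext x
  simp [Prod.ext_iff, and_comm]

lemma sum_rowCount_mul_colCount {N : ℕ} (σ : Equiv.Perm (Fin N × Fin N)) :
    ∑ z : Fin N × Fin N, rowCount σ z.1 z.2 * colCount σ z.1 z.2 = rowColCount σ := by
  unfold rowColCount
  rw [Finset.card_eq_sum_card_fiberwise (f := fun x => (x.1, x.2.1)) (t := Finset.univ)
    (fun _ _ => Finset.mem_univ _)]
  refine Finset.sum_congr rfl fun z _ => ?_
  rw [mul_comm]
  unfold rowCount colCount
  rw [← Finset.card_product]
  refine Finset.card_bij (fun y _ => (z.1, z.2, y.1, y.2)) ?_ ?_ ?_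
  · intro y hy
    simp only [Finset.mem_product, Finset.mem_filter, Finset.mem_univ, true_and] at hy ⊢
    exact ⟨Prod.ext hy.2.symm hy.1.symm, trivial⟩
  · intro y _ y' _ h
    simp only [Prod.mk.injEq, true_and] at h
    exact Prod.ext h.1 h.2
  · rintro ⟨i, j, k, l⟩ hx
    simp only [Finset.mem_filter, Finset.mem_univ, true_and] at hx
    obtain ⟨hx, rfl⟩ := hx
    refine ⟨(k, l), ?_, rfl⟩
    simp only [Finset.mem_product, Finset.mem_filter, Finset.mem_univ, true_and]
    exact ⟨(congrArg Prod.snd hx).symm, (congrArg Prod.fst hx).symm⟩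

/-- The positions at which both the row count and the column count exceed `δ N`. -/
noncomputable def largeCounts {N : ℕ} (σ : Equiv.Perm (Fin N × Fin N)) (δ : ℝ) :
    Finset (Fin N × Fin N) :=
  Finset.univ.filter fun z => δ * N < rowCount σ z.1 z.2 ∧ δ * N < colCount σ z.1 z.2

lemma card_largeCounts_mul_le {N : ℕ} (σ : Equiv.Perm (Fin N × Fin N)) {δ : ℝ} (hδ : 0 ≤ δ) :
    (largeCounts σ δ).card * (δ * N) ^ 2 ≤ rowColCount σ := by
  rw [← sum_rowCount_mul_colCount, Nat.cast_sum, ← nsmul_eq_mul]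
  calc _ ≤ ∑ z ∈ largeCounts σ δ, ((rowCount σ z.1 z.2 * colCount σ z.1 z.2 : ℕ) : ℝ) := by
        refine Finset.card_nsmul_le_sum _ _ _ fun z hz => ?_
        obtain ⟨-, h1, h2⟩ := Finset.mem_filter.1 hz
        rw [Nat.cast_mul, sq]
        gcongr
    _ ≤ _ := Finset.sum_le_sum_of_subset_of_nonneg (Finset.subset_univ _)
        fun _ _ _ => Nat.cast_nonneg _

variable {m N : ℕ} [NeZero m] {σ : Equiv.Perm (Fin N × Fin N)} {ε : Fin m → Bool}
  {α β : Equiv.Perm (Fin m)} {X : Finset (Fin m → Fin N)} {v p : ℕ → Fin m} {ord : Fin m → ℕ}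

lemma card_revealValues_le_rowCount (h : IsTour v p ord) (hX : X ⊆ pairingSolutions σ ε α β)
    {e : Fin m} (hε : ε e = true) (hα : ord (α e) < ord e) (hv : v (ord e) = e)
    (hv' : v (ord e + 1) = e + 1) {x : Fin m → Fin N} (hx : x ∈ X) :
    (revealValues X v x (ord e + 1)).card ≤ rowCount σ (x e) (x (e + 1)) := by
  refine Finset.card_le_card fun z hz => ?_
  obtain ⟨y, hy, rfl⟩ := Finset.mem_image.1 hz
  obtain ⟨hy, hyx⟩ := Finset.mem_filter.1 hy
  have hxs := ((Finset.mem_filter.1 (hX hx)).2 e).1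
  have hys := ((Finset.mem_filter.1 (hX hy)).2 e).1
  have hye : y e = x e := by simpa [hv] using hyx (ord e) (by omega)
  rw [h.edgePair_eq hyx hα, hxs] at hys
  simp only [edgePair, hε, if_true, hye] at hys
  exact Finset.mem_filter.2 ⟨Finset.mem_univ _, by rw [hv', hys]⟩

lemma card_revealValues_le_colCount (h : IsTour v p ord) (hX : X ⊆ pairingSolutions σ ε α β)
    {e : Fin m} (hε : ε e = true) (hβ : ord (β e) < ord e) (hv : v (ord e) = e + 1)
    (hv' : v (ord e + 1) = e) {x : Fin m → Fin N} (hx : x ∈ X) :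
    (revealValues X v x (ord e + 1)).card ≤ colCount σ (x e) (x (e + 1)) := by
  refine Finset.card_le_card fun z hz => ?_
  obtain ⟨y, hy, rfl⟩ := Finset.mem_image.1 hz
  obtain ⟨hy, hyx⟩ := Finset.mem_filter.1 hy
  have hxs := ((Finset.mem_filter.1 (hX hx)).2 e).2
  have hys := ((Finset.mem_filter.1 (hX hy)).2 e).2
  have hye : y (e + 1) = x (e + 1) := by simpa [hv] using hyx (ord e) (by omega)
  rw [h.edgePair_eq hyx hβ, hxs] at hys
  simp only [edgePair, hε, if_true, hye] at hys
  exact Finset.mem_filter.2 ⟨Finset.mem_univ _, by rw [hv', hys]⟩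

lemma IsTour.card_mul_pow_le (h : IsTour v p ord) (hX : X ⊆ pairingSolutions σ ε α β)
    {e : Fin m} (he : e ∉ closers ord α β) {d : ℝ} (hd : 0 ≤ d)
    (hcard : ∀ x ∈ X, ((revealValues X v x (ord e + 1)).card : ℝ) ≤ d * N) :
    X.card * (N : ℝ) ^ (closers ord α β).card ≤ d * (N : ℝ) ^ (m + 1) := by
  have h1 := h.card_le hX (k := 0) (by omega) (g := fun s => if s = e then d * N else N)
    (fun s => by split_ifs <;> positivity) (fun s _ _ x hx => by
      split_ifs with hse
      · rw [hse]
        exact hcard x hx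
      · exact_mod_cast (Finset.card_le_univ _).trans (by simp))
  have h2 : ((X.image fun x (t : Fin (0 + 1)) => x (v t)).card : ℝ) ≤ N := by
    exact_mod_cast (Finset.card_le_univ _).trans (by simp)
  have h4 := prod_ite_mem_one_mul_pow (closers ord α β) (N : ℝ) he d
  simp only [zero_le, Finset.filter_true] at h1
  rw [Fintype.card_fin] at h4
  have h5 : (0 : ℝ) ≤ ∏ s, if s ∈ closers ord α β then 1 else if s = e then d * N else N :=
    Finset.prod_nonneg fun s _ => by split_ifs <;> positivity
  calc X.card * (N : ℝ) ^ (closers ord α β).card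
      ≤ (∏ s, if s ∈ closers ord α β then 1 else if s = e then d * N else N) * N *
        (N : ℝ) ^ (closers ord α β).card := by gcongr; exact h1.trans (by gcongr)
    _ = d * (N : ℝ) ^ (m + 1) := by rw [mul_right_comm, h4]; ring

lemma IsTour.card_mul_pow_jointClasses_le (h : IsTour v p ord)
    (hX : X ⊆ pairingSolutions σ ε α β) (hN : 1 ≤ N) (hα : ∀ s, α s ≠ s) (hβ : ∀ s, β s ≠ s)
    {e : Fin m} (he : e ∉ closers ord α β) {d : ℝ} (hd : 0 ≤ d)
    (hcard : ∀ x ∈ X, ((revealValues X v x (ord e + 1)).card : ℝ) ≤ d * N) :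
    X.card * (N : ℝ) ^ jointClasses α β ≤ d * (N : ℝ) ^ (m + 1) := by
  have hN' : (1 : ℝ) ≤ N := by exact_mod_cast hN
  refine le_trans ?_ (h.card_mul_pow_le hX he hd hcard)
  gcongr
  exact jointClasses_le_card_closers h.injective hα hβ

lemma card_mul_pow_le_of_start (hX : X ⊆ pairingSolutions σ ε α β) (hN : 1 ≤ N)
    (hα : ∀ s, α s ≠ s) (hβ : ∀ s, β s ≠ s) (e : Fin m) {B : Finset (Fin N × Fin N)}
    (hB : ∀ x ∈ X, (x e, x (e + 1)) ∈ B) :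
    X.card * (N : ℝ) ^ jointClasses α β * N ≤ B.card * (N : ℝ) ^ m := by
  obtain ⟨v, p, ord, h, he, hv0, hv1⟩ := exists_isTour_start e
  have hN' : (1 : ℝ) ≤ N := by exact_mod_cast hN
  have hecl : e ∉ closers ord α β := by simp [closers, he]
  have h1 := h.card_le hX (k := 1) NeZero.one_le (g := fun s => N)
    (fun s => by positivity) (fun s _ _ x hx => by
      exact_mod_cast (Finset.card_le_univ _).trans (by simp))
  have h2 : ((X.image fun x (t : Fin (1 + 1)) => x (v t)).card : ℝ) ≤ B.card := by
    rw [Nat.cast_le]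
    refine Finset.card_le_card_of_injOn (fun z => (z 0, z 1)) ?_ ?_
    · intro z hz
      obtain ⟨x, hx, rfl⟩ := Finset.mem_image.1 hz
      simpa [hv0, hv1] using hB x hx
    · intro z _ z' _ hzz
      simp only [Prod.mk.injEq] at hzz
      funext t
      fin_cases t
      · exact hzz.1
      · exact hzz.2
  have h3 : (N : ℝ) ^ jointClasses α β ≤ (N : ℝ) ^ (closers ord α β).card :=
    pow_le_pow_right₀ hN' (jointClasses_le_card_closers h.injective hα hβ)
  have h4 := prod_ite_mem_one_mul_pow (closers ord α β) (N : ℝ) hecl 1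
  have hfilter : (Finset.univ.filter fun s => 1 ≤ ord s) = Finset.univ.erase e := by
    ext s
    simp only [Finset.mem_filter, Finset.mem_univ, true_and, Finset.mem_erase, and_true]
    rw [Nat.one_le_iff_ne_zero, ← he, h.injective.ne_iff]
  rw [hfilter] at h1
  simp only [one_mul, ite_self, Fintype.card_fin] at h4
  rw [← Finset.mul_prod_erase _ _ (Finset.mem_univ e), if_neg hecl] at h4
  have h5 : (0 : ℝ) ≤ ∏ s ∈ Finset.univ.erase e, if s ∈ closers ord α β then 1 else (N : ℝ) :=
    Finset.prod_nonneg fun s _ => by split_ifs <;> positivity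
  calc X.card * (N : ℝ) ^ jointClasses α β * N
      ≤ (∏ s ∈ Finset.univ.erase e, if s ∈ closers ord α β then 1 else (N : ℝ)) * B.card *
        (N : ℝ) ^ (closers ord α β).card * N := by gcongr; exact h1.trans (by gcongr)
    _ = B.card * (N : ℝ) ^ m := by rw [← h4]; ring

lemma card_pairingSolutions_le_of_cyclic (hN : 1 ≤ N) (hα : ∀ s, α s ≠ s) (hβ : ∀ s, β s ≠ s)
    {e : Fin m} (hε : ε e = true)
    (h : (e < β e ∧ β e < α e) ∨ (β e < α e ∧ α e < e) ∨ (α e < e ∧ e < β e))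
    {δ : ℝ} (hδ : 0 < δ) :
    (pairingSolutions σ ε α β).card * (N : ℝ) ^ jointClasses α β ≤
      (2 * δ + rowColCount σ / (N : ℝ) ^ 4 / δ ^ 2) * (N : ℝ) ^ (m + 1) := by
  classical
  have hN0 : (0 : ℝ) < N := by exact_mod_cast hN
  set X := pairingSolutions σ ε α β with hXdef
  set X₁ := X.filter fun x => (rowCount σ (x e) (x (e + 1)) : ℝ) ≤ δ * N with hX₁
  set X₂ := X.filter fun x => (colCount σ (x e) (x (e + 1)) : ℝ) ≤ δ * N with hX₂
  set X₃ := X.filter fun x => (x e, x (e + 1)) ∈ largeCounts σ δ with hX₃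
  have hcover : X ⊆ X₁ ∪ X₂ ∪ X₃ := by
    intro x hx
    simp only [hX₁, hX₂, hX₃, Finset.mem_union, Finset.mem_filter, hx, true_and, largeCounts,
      Finset.mem_univ]
    by_cases h1 : (rowCount σ (x e) (x (e + 1)) : ℝ) ≤ δ * N
    · exact Or.inl (Or.inl h1)
    by_cases h2 : (colCount σ (x e) (x (e + 1)) : ℝ) ≤ δ * N
    · exact Or.inl (Or.inr h2)
    · exact Or.inr ⟨not_le.1 h1, not_le.1 h2⟩
  have hb₁ : X₁.card * (N : ℝ) ^ jointClasses α β ≤ δ * (N : ℝ) ^ (m + 1) := by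
    obtain ⟨v, p, ord, ht, h1, h2, hv, hv'⟩ := exists_isTour_forward h
    refine ht.card_mul_pow_jointClasses_le (Finset.filter_subset _ _) hN hα hβ (e := e)
      (by simp [closers, h2.le]) hδ.le fun x hx => ?_
    refine le_trans ?_ (Finset.mem_filter.1 hx).2
    exact_mod_cast card_revealValues_le_rowCount ht (Finset.filter_subset _ _) hε h1 hv hv' hx
  have hb₂ : X₂.card * (N : ℝ) ^ jointClasses α β ≤ δ * (N : ℝ) ^ (m + 1) := by
    obtain ⟨v, p, ord, ht, h1, h2, hv, hv'⟩ := exists_isTour_backward h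
    refine ht.card_mul_pow_jointClasses_le (Finset.filter_subset _ _) hN hα hβ (e := e)
      (by simp [closers, h2.le]) hδ.le fun x hx => ?_
    refine le_trans ?_ (Finset.mem_filter.1 hx).2
    exact_mod_cast card_revealValues_le_colCount ht (Finset.filter_subset _ _) hε h1 hv hv' hx
  have hb₃ : X₃.card * (N : ℝ) ^ jointClasses α β ≤
      rowColCount σ / (N : ℝ) ^ 4 / δ ^ 2 * (N : ℝ) ^ (m + 1) := by
    have h1 := card_mul_pow_le_of_start (X := X₃) (Finset.filter_subset _ _) hN hα hβ e
      (B := largeCounts σ δ) fun x hx => (Finset.mem_filter.1 hx).2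
    have h2 := card_largeCounts_mul_le σ hδ.le
    have h3 : X₃.card * (N : ℝ) ^ jointClasses α β * N * (δ * N) ^ 2 ≤
        rowColCount σ * (N : ℝ) ^ m := by
      calc _ ≤ (largeCounts σ δ).card * (N : ℝ) ^ m * (δ * N) ^ 2 := by gcongr
        _ = (largeCounts σ δ).card * (δ * N) ^ 2 * (N : ℝ) ^ m := by ring
        _ ≤ _ := by gcongr
    rw [div_div, div_mul_eq_mul_div, le_div_iff₀ (by positivity)]
    calc _ = X₃.card * (N : ℝ) ^ jointClasses α β * N * (δ * N) ^ 2 * N := by ring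
      _ ≤ rowColCount σ * (N : ℝ) ^ m * N := by gcongr
      _ = _ := by ring
  have hcard : (X.card : ℝ) ≤ X₁.card + X₂.card + X₃.card := by
    exact_mod_cast (Finset.card_le_card hcover).trans ((Finset.card_union_le _ _).trans
      (Nat.add_le_add_right (Finset.card_union_le _ _) _))
  calc _ ≤ (X₁.card + X₂.card + X₃.card : ℝ) * (N : ℝ) ^ jointClasses α β := by gcongr
    _ ≤ _ := by linarith

lemma card_pairingSolutions_swap :
    pairingSolutions (σ.trans (Equiv.prodComm _ _)) ε β α = pairingSolutions σ ε α β := by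
  unfold pairingSolutions
  ext i
  simp [and_comm]

lemma card_pairingSolutions_le_of_ne (hN : 1 ≤ N) (hα : IsSignPairing ε Finset.univ α)
    (hβ : IsSignPairing ε Finset.univ β) (hne : α ≠ β) {δ : ℝ} (hδ : 0 < δ) :
    (pairingSolutions σ ε α β).card * (N : ℝ) ^ jointClasses α β ≤
      (2 * δ + Zcnt N σ / (N : ℝ) ^ 4 / δ ^ 2) * (N : ℝ) ^ (m + 1) := by
  have hα' : ∀ s, α s ≠ s := fun s h => hα.2.1 s (Finset.mem_univ _) (congrArg ε h)
  have hβ' : ∀ s, β s ≠ s := fun s h => hβ.2.1 s (Finset.mem_univ _) (congrArg ε h)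
  obtain ⟨e, hε, he⟩ : ∃ e, ε e = true ∧ α e ≠ β e := by
    obtain ⟨s, hs⟩ : ∃ s, α s ≠ β s := by
      by_contra! h
      exact hne (Equiv.ext h)
    by_cases hε : ε s = true
    · exact ⟨s, hε, hs⟩
    · refine ⟨α s, ?_, fun h => hs ?_⟩
      · have := hα.2.1 s (Finset.mem_univ _)
        simpa [hε] using this
      · rw [hα.1 s] at h
        have := congrArg β h
        rw [hβ.1] at this
        exact this.symm
  have h1 := hα' e
  have h2 := hβ' e
  rw [Zcnt_eq, Nat.cast_add]
  by_cases h : (e < β e ∧ β e < α e) ∨ (β e < α e ∧ α e < e) ∨ (α e < e ∧ e < β e)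
  · refine (card_pairingSolutions_le_of_cyclic hN hα' hβ' hε h hδ).trans ?_
    gcongr
    simp
  · have h' : (e < α e ∧ α e < β e) ∨ (α e < β e ∧ β e < e) ∨ (β e < e ∧ e < α e) := by
      omega
    rw [← card_pairingSolutions_swap, jointClasses_comm]
    refine (card_pairingSolutions_le_of_cyclic hN hβ' hα' hε h' hδ).trans ?_
    gcongr
    simp

end DistinctPairings

section EqualPairings

variable {m N : ℕ}

/-- The pairing `α` has two crossing pairs. -/
def HasCrossing (α : Equiv.Perm (Fin m)) : Prop :=
  ∃ a b : Fin m, a < b ∧ b < α a ∧ α a < α b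

lemma IsSignPairing.apply_ne {ε : Fin m → Bool} {α : Equiv.Perm (Fin m)}
    (hα : IsSignPairing ε Finset.univ α) (s : Fin m) : α s ≠ s :=
  fun h => hα.2.1 s (Finset.mem_univ _) (congrArg ε h)

/-- An involution exchanging a set with its complement halves the number of points. -/
lemma two_mul_card_filter {ι : Type*} [Fintype ι] {α : Equiv.Perm ι} {P : ι → Prop}
    [DecidablePred P] (h : ∀ s, P (α s) ↔ ¬ P s) :
    2 * (Finset.univ.filter P).card = Fintype.card ι := by
  have h1 : (Finset.univ.filter P).card = (Finset.univ.filter fun s => ¬ P s).card :=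
    Finset.card_equiv α.symm fun s => by
      simp only [Finset.mem_filter, Finset.mem_univ, true_and]
      rw [← h, Equiv.apply_symm_apply]
  have h2 := Finset.card_filter_add_card_filter_not (s := Finset.univ) P
  rw [Finset.card_univ] at h2
  omega

lemma IsSignPairing.two_mul_card {ε : Fin m → Bool} {α : Equiv.Perm (Fin m)}
    (hα : IsSignPairing ε Finset.univ α) :
    2 * (Finset.univ.filter fun s => ¬ ε s = true).card = m := by
  rw [two_mul_card_filter (α := α) fun s => ?_, Fintype.card_fin]
  have := hα.2.1 s (Finset.mem_univ _)
  cases h : ε s <;> cases h' : ε (α s) <;> simp_all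

lemma IsSignPairing.two_mul_card_openers {ε : Fin m → Bool} {α : Equiv.Perm (Fin m)}
    (hα : IsSignPairing ε Finset.univ α) :
    2 * (Finset.univ.filter fun s => s < α s).card = m := by
  rw [two_mul_card_filter (α := α) fun s => ?_, Fintype.card_fin]
  rw [hα.1 s, not_lt]
  exact ⟨le_of_lt, fun h => lt_of_le_of_ne h (hα.apply_ne s)⟩

lemma IsSignPairing.two_mul_card_closers {ε : Fin m → Bool} {α : Equiv.Perm (Fin m)}
    (hα : IsSignPairing ε Finset.univ α) :
    2 * (closers (fun s : Fin m => (s : ℕ)) α α).card = m := by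
  unfold closers
  rw [two_mul_card_filter (α := α) fun s => ?_, Fintype.card_fin]
  rw [hα.1 s]
  have := hα.apply_ne s
  dsimp only
  omega

variable [NeZero m] {σ : Equiv.Perm (Fin N × Fin N)} {ε : Fin m → Bool} {α : Equiv.Perm (Fin m)}

lemma mem_pairingSolutions_self (hα : IsSignPairing ε Finset.univ α) {i : Fin m → Fin N} :
    i ∈ pairingSolutions σ ε α α ↔ ∀ s, i s = i (α s + 1) := by
  have hedge : ∀ s, edgePair ε (α s) i = edgePair ε s i ↔
      i (α s) = i (s + 1) ∧ i (α s + 1) = i s := by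
    intro s
    have := hα.2.1 s (Finset.mem_univ _)
    unfold edgePair
    cases h : ε s <;> cases h' : ε (α s) <;> simp_all [and_comm]
  have : i ∈ pairingSolutions σ ε α α ↔ ∀ s, edgePair ε (α s) i = edgePair ε s i := by
    simp only [pairingSolutions, Finset.mem_filter, Finset.mem_univ, true_and]
    exact forall_congr' fun s => by rw [← Prod.ext_iff, σ.injective.eq_iff]
  rw [this]
  simp only [hedge]
  refine ⟨fun h s => (h s).2.symm, fun h s => ⟨?_, (h s).symm⟩⟩
  rw [h (α s), hα.1]

lemma card_pairingSolutions_self_le (hα : IsSignPairing ε Finset.univ α) (hN : 1 ≤ N) :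
    ((pairingSolutions σ ε α α).card : ℝ) ≤
      (N : ℝ) ^ ((Finset.univ.filter fun s => ¬ ε s = true).card + 1) := by
  have hN0 : (0 : ℝ) < N := by exact_mod_cast hN
  have h1 := isTour_val.card_mul_pow_le (X := pairingSolutions σ ε α α) subset_rfl (e := 0)
    (by simp [closers]) zero_le_one fun x _ => by
      rw [one_mul]
      exact_mod_cast (Finset.card_le_univ _).trans (by simp)
  have h2 := hα.two_mul_card
  have h3 := hα.two_mul_card_closers
  refine le_of_mul_le_mul_right (h1.trans_eq ?_)
    (pow_pos hN0 (closers (fun s : Fin m => (s : ℕ)) α α).card)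
  rw [one_mul, ← pow_add]
  congr 1
  omega

/-- Along a crossing of minimal gap, the value after the second opening is determined by an
earlier value. -/
lemma exists_determined_of_hasCrossing (hα : IsSignPairing ε Finset.univ α) (h : HasCrossing α) :
    ∃ b u : Fin m, b < α b ∧ u ≤ b ∧
      ∀ i ∈ pairingSolutions (N := N) σ ε α α, i (b + 1) = i u := by
  classical
  obtain ⟨⟨a, b⟩, hmem, hmin⟩ := Finset.exists_min_image
    (Finset.univ.filter fun z : Fin m × Fin m => z.1 < z.2 ∧ z.2 < α z.1 ∧ α z.1 < α z.2)
    (fun z => (α z.1 : ℕ) - z.2) (by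
      obtain ⟨a, b, h⟩ := h
      exact ⟨(a, b), by simpa using h⟩)
  simp only [Finset.mem_filter, Finset.mem_univ, true_and, Prod.forall] at hmem hmin
  obtain ⟨hab, hba, haαb⟩ := hmem
  have hinv := hα.1
  have hsucc : ∀ c d : Fin m, c < d → ((c + 1 : Fin m) : ℕ) = c + 1 := fun c d hcd => by
    rw [val_fin_add_one, if_neg]
    omega
  refine ⟨b, a + 1, hba.trans haαb, ?_, fun i hi => ?_⟩
  · rw [Fin.le_def, hsucc a b hab]
    exact hab
  rw [mem_pairingSolutions_self hα] at hi
  have hclosed : ∀ p, b < p → p < α a → b < α p ∧ α p < α a := by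
    intro p hbp hpt
    have h1 : α p ≠ b := fun h => by rw [← h, hinv] at haαb; omega
    have h2 : α p ≠ α a := fun h => by have := α.injective h; omega
    constructor
    · by_contra hlt
      have := hmin (α p) b ⟨by omega, by rw [hinv]; omega, by rw [hinv]; omega⟩
      rw [hinv] at this
      omega
    · by_contra hlt
      have := hmin a p ⟨by omega, hpt, by omega⟩
      omega
  have hkey : ∀ n : ℕ, ∀ u : Fin m, (u : ℕ) = n → b < u → u ≤ α a →
      (∀ p, b < p → p < u → b < α p ∧ α p < u) → i u = i (b + 1) := by
    intro n
    induction n using Nat.strong_induction_on with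
    | _ n ih =>
      intro u hun hbu hut hcl
      rcases eq_or_ne (u : ℕ) (b + 1) with h | h
      · congr 1
        exact Fin.ext (h.trans (hsucc b u hbu).symm)
      · let q : Fin m := ⟨u - 1, by omega⟩
        have hq : (q : ℕ) = u - 1 := rfl
        obtain ⟨h1, h2⟩ := hcl q (by omega) (by omega)
        have h3 := hα.apply_ne q
        have h4 : i (α q) = i u := by
          rw [hi (α q), hinv]
          congr 1
          apply Fin.ext
          rw [hsucc q u (by omega)]
          omega
        rw [← h4]
        refine ih (α q) (by omega) (α q) rfl h1 (by omega) fun p hp hpw => ?_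
        obtain ⟨h5, h6⟩ := hcl p hp (by omega)
        refine ⟨h5, ?_⟩
        by_contra hlt
        have h7 : α p ≠ α q := fun h => by have := α.injective h; omega
        have h8 : α p ≠ q := fun h => by rw [← h, hinv] at hpw; omega
        have := hmin p (α q) ⟨by omega, by omega, by rw [hinv]; omega⟩
        omega
  rw [← hkey _ (α a) rfl hba le_rfl hclosed, hi (α a), hinv]

lemma card_pairingSolutions_self_le_of_hasCrossing (hα : IsSignPairing ε Finset.univ α)
    (h : HasCrossing α) (hN : 1 ≤ N) :
    ((pairingSolutions σ ε α α).card : ℝ) ≤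
      (N : ℝ) ^ (Finset.univ.filter fun s => ¬ ε s = true).card := by
  have hN0 : (0 : ℝ) < N := by exact_mod_cast hN
  obtain ⟨b, u, hb, hu, hdet⟩ := exists_determined_of_hasCrossing (N := N) (σ := σ) hα h
  have h1 := isTour_val.card_mul_pow_le (X := pairingSolutions σ ε α α) subset_rfl (e := b)
    (by simp only [closers, Finset.mem_filter]; omega) (inv_nonneg.2 hN0.le) fun x hx => by
      rw [inv_mul_cancel₀ hN0.ne', Nat.cast_le_one]
      refine (Finset.card_le_card (t := {x u}) fun z hz => ?_).trans (by simp)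
      obtain ⟨y, hy, rfl⟩ := Finset.mem_image.1 hz
      obtain ⟨hy, hyx⟩ := Finset.mem_filter.1 hy
      have h2 : Fin.ofNat m (b + 1) = b + 1 := by
        apply Fin.ext
        simp [Fin.val_add]
      have h3 := hyx u (by omega)
      have h4 : Fin.ofNat m u = u := by
        apply Fin.ext
        simp
      dsimp only at h3 ⊢
      rw [h4] at h3
      rw [Finset.mem_singleton, h2, hdet y hy, h3]
  have h2 := hα.two_mul_card
  have h3 := hα.two_mul_card_closers
  refine le_of_mul_le_mul_right (h1.trans_eq ?_)
    (pow_pos hN0 (closers (fun s : Fin m => (s : ℕ)) α α).card)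
  rw [← pow_add, pow_succ, mul_comm, mul_assoc, mul_inv_cancel₀ hN0.ne', mul_one]
  congr 1
  omega

/-- The openings of the pairs that enclose the vertex `v`. -/
def enclosing (α : Equiv.Perm (Fin m)) (v : Fin m) : Finset (Fin m) :=
  Finset.univ.filter fun p => p < v ∧ v ≤ α p

lemma enclosing_eq (hα : IsSignPairing ε Finset.univ α) (h : ¬ HasCrossing α) (s : Fin m) :
    enclosing α s = enclosing α (α s + 1) := by
  have hinv := hα.1
  have hnc : ∀ a b, a < b → b < α a → ¬ α a < α b := fun a b h1 h2 h3 => h ⟨a, b, h1, h2, h3⟩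
  ext p
  simp only [enclosing, Finset.mem_filter, Finset.mem_univ, true_and, Fin.lt_def, Fin.le_def,
    val_fin_add_one]
  have h1 := hnc p s
  have h2 := hnc p (α s)
  have h3 := hnc (α s) p
  have h4 := hnc s p
  rw [hinv] at h2 h3
  have h5 : α p = s ↔ p = α s := ⟨fun h => by rw [← h, hinv], fun h => by rw [h, hinv]⟩
  have h6 : α p = α s ↔ p = s := α.injective.eq_iff
  have h7 := hα.apply_ne s
  have h8 := hα.apply_ne p
  have h9 := (α p).2
  have h10 := (α s).2
  split_ifs <;> omega

lemma pow_le_card_pairingSolutions_self (hα : IsSignPairing ε Finset.univ α)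
    (h : ¬ HasCrossing α) (hN : 1 ≤ N) :
    N ^ ((Finset.univ.filter fun s => ¬ ε s = true).card + 1) ≤
      (pairingSolutions (N := N) σ ε α α).card := by
  classical
  set R := Finset.univ.image (enclosing α) with hR
  have hRcard : (Finset.univ.filter fun s => ¬ ε s = true).card + 1 ≤ R.card := by
    have h1 := hα.two_mul_card
    have h2 := hα.two_mul_card_openers
    have hval : ∀ s, s < α s → ((s + 1 : Fin m) : ℕ) = s + 1 := fun s hs => by
      rw [val_fin_add_one, if_neg]
      omega
    have hmem : ∀ s, s < α s → s ∈ enclosing α (s + 1) := fun s hs => by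
      simp only [enclosing, Finset.mem_filter, Finset.mem_univ, true_and, Fin.lt_def, Fin.le_def,
        hval s hs]
      omega
    have hinj : Set.InjOn (fun s => enclosing α (s + 1))
        (Finset.univ.filter fun s => s < α s : Finset (Fin m)) := by
      intro s hs t ht hst
      have hs' : s < α s := by simpa using hs
      have ht' : t < α t := by simpa using ht
      have h3 := hmem s hs'
      have h4 := hmem t ht'
      dsimp only at hst
      rw [hst] at h3
      rw [← hst] at h4
      simp only [enclosing, Finset.mem_filter, Fin.lt_def, hval s hs', hval t ht'] at h3 h4
      omega
    have hnot : ∅ ∉ (Finset.univ.filter fun s => s < α s).image fun s => enclosing α (s + 1) := by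
      intro h0
      obtain ⟨s, hs, h0⟩ := Finset.mem_image.1 h0
      have := hmem s (Finset.mem_filter.1 hs).2
      simp [h0] at this
    have hsub : insert ∅ ((Finset.univ.filter fun s => s < α s).image
        fun s => enclosing α (s + 1)) ⊆ R := by
      refine Finset.insert_subset ?_ ?_
      · exact Finset.mem_image.2 ⟨0, Finset.mem_univ _, by simp [enclosing]⟩
      · exact Finset.image_subset_iff.2 fun s _ =>
          Finset.mem_image_of_mem _ (Finset.mem_univ _)
    have h5 := Finset.card_le_card hsub
    rw [Finset.card_insert_of_notMem hnot, Finset.card_image_of_injOn hinj] at h5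
    omega
  calc N ^ ((Finset.univ.filter fun s => ¬ ε s = true).card + 1) ≤ N ^ R.card :=
        Nat.pow_le_pow_right hN hRcard
    _ = (Finset.univ : Finset (R → Fin N)).card := by simp
    _ ≤ _ := by
        refine Finset.card_le_card_of_injOn
          (fun F v => F ⟨enclosing α v, Finset.mem_image_of_mem _ (Finset.mem_univ _)⟩) ?_ ?_
        · intro F _
          refine (mem_pairingSolutions_self hα).2 fun s => ?_
          simp only [enclosing_eq hα h s]
        · intro F _ G _ hFG
          funext ⟨r, hr⟩
          obtain ⟨v, -, rfl⟩ := Finset.mem_image.1 hr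
          exact congrFun hFG v

end EqualPairings

section TraceExpansion

variable {N : ℕ}

/-- The entries of a product of matrices as a sum over paths. -/
lemma ofFn_prod_apply {R : Type*} [CommSemiring R] {n : Type*} [Fintype n] [DecidableEq n] {k : ℕ}
    (M : Fin (k + 1) → Matrix n n R) (x y : n) :
    (List.ofFn M).prod x y =
      ∑ i : Fin k → n, ∏ s, M s (Fin.cons (α := fun _ => n) x i s)
        (Fin.snoc (α := fun _ => n) i y s) := by
  induction k generalizing x with
  | zero => simp [Fin.snoc]
  | succ k ih =>
    rw [List.ofFn_succ, List.prod_cons, Matrix.mul_apply,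
      ← (Fin.consEquiv fun _ : Fin (k + 1) => n).sum_comp, Fintype.sum_prod_type]
    refine Finset.sum_congr rfl fun z _ => ?_
    rw [ih, Finset.mul_sum]
    refine Finset.sum_congr rfl fun i _ => ?_
    change _ = ∏ s, M s (Fin.cons (α := fun _ => n) x (Fin.cons (α := fun _ => n) z i) s)
      (Fin.snoc (α := fun _ => n) (Fin.cons (α := fun _ => n) z i) y s)
    rw [← Fin.cons_snoc_eq_snoc_cons, Fin.prod_univ_succ (n := k + 1)]
    simp only [Fin.cons_zero, Fin.cons_succ]

/-- The trace of a product of matrices as a sum over closed paths. -/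
lemma trace_ofFn_prod {R : Type*} [CommSemiring R] {n : Type*} [Fintype n] [DecidableEq n] {m : ℕ}
    [NeZero m] (M : Fin m → Matrix n n R) :
    ((List.ofFn M).prod).trace = ∑ i : Fin m → n, ∏ s, M s (i s) (i (s + 1)) := by
  obtain ⟨k, rfl⟩ := Nat.exists_eq_succ_of_ne_zero (NeZero.ne m)
  rw [← (Fin.consEquiv fun _ : Fin (k + 1) => n).sum_comp, Fintype.sum_prod_type, Matrix.trace]
  refine Finset.sum_congr rfl fun x _ => ?_
  rw [Matrix.diag_apply, ofFn_prod_apply]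
  refine Finset.sum_congr rfl fun i _ => Finset.prod_congr rfl fun s _ => ?_
  congr 1
  refine Fin.lastCases ?_ (fun t => ?_) s
  · simp
  · rw [Fin.snoc_castSucc, Fin.coeSucc_eq_succ]
    rfl

variable {m : ℕ} [NeZero m]

lemma starPow_permMat_apply (σ : Equiv.Perm (Fin N × Fin N)) (U : Matrix (Fin N) (Fin N) ℂ)
    (ε : Fin m → Bool) (s : Fin m) (i : Fin m → Fin N) :
    starPow (permMat σ U) (ε s) (i s) (i (s + 1)) =
      entryPow U (ε s) (σ (edgePair ε s i)).1 (σ (edgePair ε s i)).2 := by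
  unfold starPow entryPow edgePair
  cases ε s <;> simp [permMat]

lemma integral_trace_eq {μ : Measure (Matrix (Fin N) (Fin N) ℂ)} (hμ : IsHaarUnitary N μ)
    (σ : Equiv.Perm (Fin N × Fin N)) (ε : Fin m → Bool) :
    ∫ U, (N : ℂ)⁻¹ *
        Matrix.trace ((List.ofFn fun s : Fin m => starPow (permMat σ U) (ε s)).prod) ∂μ =
      (N : ℂ)⁻¹ * ∑ i : Fin m → Fin N, mixedMoment μ ε Finset.univ
        (fun s => (σ (edgePair ε s i)).1) fun s => (σ (edgePair ε s i)).2 := by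
  simp only [trace_ofFn_prod, starPow_permMat_apply]
  rw [integral_const_mul, integral_finsetSum _ fun i _ => hμ.integrable_prod ε _ _ _]
  rfl

lemma sum_fixInd_mul_fixInd (σ : Equiv.Perm (Fin N × Fin N)) (ε : Fin m → Bool)
    (α β : Equiv.Perm (Fin m)) :
    ∑ i : Fin m → Fin N, fixInd α (fun s => (σ (edgePair ε s i)).1) *
      fixInd β (fun s => (σ (edgePair ε s i)).2) = ((pairingSolutions σ ε α β).card : ℂ) := by
  classical
  rw [pairingSolutions, Finset.card_filter, Nat.cast_sum]
  refine Finset.sum_congr rfl fun i _ => ?_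
  simp only [fixInd, funext_iff, Function.comp_apply, ← ite_and, ite_mul, one_mul, zero_mul,
    ← forall_and]
  split_ifs <;> simp

lemma sum_pairSum (σ : Equiv.Perm (Fin N × Fin N)) (ε : Fin m → Bool)
    (w : Equiv.Perm (Fin m) → Equiv.Perm (Fin m) → ℂ) :
    ∑ i : Fin m → Fin N, pairSum w (fun s => (σ (edgePair ε s i)).1)
      (fun s => (σ (edgePair ε s i)).2) =
    ∑ α, ∑ β, w α β * (pairingSolutions σ ε α β).card := by
  simp only [pairSum, ← sum_fixInd_mul_fixInd, Finset.mul_sum, mul_assoc]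
  rw [Finset.sum_comm]
  exact Finset.sum_congr rfl fun α _ => Finset.sum_comm

end TraceExpansion

section Limit

variable {m : ℕ} {ε : Fin m → Bool} {α β : Equiv.Perm (Fin m)}
  {μ : (N : ℕ) → Measure (Matrix (Fin N) (Fin N) ℂ)} {σ : (N : ℕ) → Equiv.Perm (Fin N × Fin N)}
  {w : ℕ → Equiv.Perm (Fin m) → Equiv.Perm (Fin m) → ℂ} {C : ℝ} {J : ℕ}

lemma ncPairings_eq_sum [DecidablePred (HasCrossing (m := m))]
    [DecidablePred (IsSignPairing ε Finset.univ)] :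
    (ncPairings m ε : ℂ) = ∑ α : Equiv.Perm (Fin m), ∑ β : Equiv.Perm (Fin m),
      if α = β ∧ IsSignPairing ε Finset.univ α ∧ ¬ HasCrossing α then 1 else 0 := by
  have h : {π : Equiv.Perm (Fin m) | Function.Involutive π ∧ (∀ s, π s ≠ s) ∧
      (∀ s, ε (π s) ≠ ε s) ∧ ¬ ∃ a b : Fin m, a < b ∧ b < π a ∧ π a < π b} =
      ↑(Finset.univ.filter fun α : Equiv.Perm (Fin m) =>
        IsSignPairing ε Finset.univ α ∧ ¬ HasCrossing α) := by
    ext α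
    simp only [Set.mem_ofPred_eq, Finset.coe_filter, Finset.mem_univ, true_and]
    constructor
    · rintro ⟨h1, -, h3, h4⟩
      exact ⟨⟨h1, fun s _ => h3 s, fun s hs => absurd (Finset.mem_univ s) hs⟩, h4⟩
    · rintro ⟨h1, h4⟩
      exact ⟨h1.1, h1.apply_ne, fun s => h1.2.1 s (Finset.mem_univ s), h4⟩
  rw [ncPairings, h, Set.ncard_coe_finset, Finset.card_filter, Nat.cast_sum]
  refine Finset.sum_congr rfl fun α _ => ?_
  simp [ite_and]

variable [NeZero m]

lemma tendsto_card_pairingSolutions_of_ne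
    (hC1 : Tendsto (fun N : ℕ => (Zcnt N (σ N) : ℝ) / (N : ℝ) ^ 4) atTop (nhds 0))
    (hα : IsSignPairing ε Finset.univ α) (hβ : IsSignPairing ε Finset.univ β) (hne : α ≠ β) :
    Tendsto (fun N : ℕ => ((pairingSolutions (σ N) ε α β).card : ℝ) *
      (N : ℝ) ^ jointClasses α β / (N : ℝ) ^ (m + 1)) atTop (nhds 0) := by
  rw [Metric.tendsto_nhds]
  intro e he
  have hδ : 0 < e / 4 := by positivity
  have hlim : Tendsto (fun N : ℕ => 2 * (e / 4) + (Zcnt N (σ N) : ℝ) / (N : ℝ) ^ 4 / (e / 4) ^ 2)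
      atTop (nhds (2 * (e / 4) + 0 / (e / 4) ^ 2)) := (hC1.div_const _).const_add _
  filter_upwards [hlim.eventually_lt_const (u := e) (by rw [zero_div]; linarith),
    eventually_ge_atTop 1] with N hlt hN
  have hN0 : (0 : ℝ) < N := by exact_mod_cast hN
  rw [Real.dist_0_eq_abs, abs_of_nonneg (by positivity)]
  refine lt_of_le_of_lt ?_ hlt
  rw [div_le_iff₀ (by positivity)]
  exact card_pairingSolutions_le_of_ne hN hα hβ hne hδ

lemma tendsto_card_pairingSolutions_self [Decidable (HasCrossing α)]
    (hα : IsSignPairing ε Finset.univ α) :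
    Tendsto (fun N : ℕ => ((pairingSolutions (σ N) ε α α).card : ℝ) /
      (N : ℝ) ^ ((Finset.univ.filter fun s => ¬ ε s = true).card + 1)) atTop
      (nhds (if HasCrossing α then 0 else 1)) := by
  split_ifs with h
  · refine tendsto_of_tendsto_of_tendsto_of_le_of_le' tendsto_const_nhds
      (tendsto_inv_atTop_nhds_zero_nat (𝕜 := ℝ)) (Eventually.of_forall fun N => by positivity) ?_
    filter_upwards [eventually_ge_atTop 1] with N hN
    have hN0 : (0 : ℝ) < N := by exact_mod_cast hN
    rw [div_le_iff₀ (by positivity), pow_succ', inv_mul_cancel_left₀ hN0.ne']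
    exact card_pairingSolutions_self_le_of_hasCrossing hα h hN
  · refine tendsto_const_nhds.congr' ?_
    filter_upwards [eventually_ge_atTop 1] with N hN
    have hN0 : (0 : ℝ) < N := by exact_mod_cast hN
    rw [eq_comm, div_eq_one_iff_eq (by positivity)]
    refine le_antisymm (card_pairingSolutions_self_le hα hN) ?_
    exact_mod_cast pow_le_card_pairingSolutions_self (σ := σ N) hα h hN

lemma IsMomentExpansion.tendsto_of_ne (hw : IsMomentExpansion μ ε Finset.univ J w C)
    (hC1 : Tendsto (fun N : ℕ => (Zcnt N (σ N) : ℝ) / (N : ℝ) ^ 4) atTop (nhds 0))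
    (hα : IsSignPairing ε Finset.univ α) (hβ : IsSignPairing ε Finset.univ β) (hne : α ≠ β) :
    Tendsto (fun N : ℕ => (N : ℂ)⁻¹ * (w N α β * (pairingSolutions (σ N) ε α β).card)) atTop
      (nhds 0) := by
  have h := (tendsto_card_pairingSolutions_of_ne hC1 hα hβ hne).const_mul C
  rw [mul_zero] at h
  refine squeeze_zero_norm' ?_ h
  filter_upwards [eventually_ge_atTop 1] with N hN
  have hN0 : (0 : ℝ) < N := by exact_mod_cast hN
  have hb := hw.bound N hN α β
  rw [Nat.card_eq_fintype_card, Fintype.card_fin, ← le_div_iff₀ (by positivity)] at hb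
  rw [norm_mul, norm_mul, norm_inv, Complex.norm_natCast, Complex.norm_natCast]
  calc (N : ℝ)⁻¹ * (‖w N α β‖ * (pairingSolutions (σ N) ε α β).card)
      ≤ (N : ℝ)⁻¹ * (C * (N : ℝ) ^ jointClasses α β / (N : ℝ) ^ m *
          (pairingSolutions (σ N) ε α β).card) := by gcongr
    _ = _ := by
      rw [pow_succ]
      field_simp

lemma IsMomentExpansion.tendsto_self [Decidable (HasCrossing α)]
    (hw : IsMomentExpansion μ ε Finset.univ J w C) (hJ : 1 ≤ J)
    (hα : IsSignPairing ε Finset.univ α) :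
    Tendsto (fun N : ℕ => (N : ℂ)⁻¹ * (w N α α * (pairingSolutions (σ N) ε α α).card)) atTop
      (nhds (if HasCrossing α then 0 else 1)) := by
  set n := (Finset.univ.filter fun s => ¬ ε s = true).card with hn
  have h1 : Tendsto (fun N : ℕ => w N α α * (N : ℂ) ^ n) atTop (nhds 1) := by
    rw [tendsto_iff_norm_sub_tendsto_zero]
    refine squeeze_zero' (Eventually.of_forall fun _ => norm_nonneg _) ?_
      (tendsto_const_div_atTop_nhds_zero_nat C)
    filter_upwards [eventually_ge_atTop 1] with N hN
    rw [le_div_iff₀ (by exact_mod_cast hN)]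
    exact hw.diag (Or.inr hJ) N hN α hα
  have h2 := (Complex.continuous_ofReal.tendsto _).comp
    (tendsto_card_pairingSolutions_self (σ := σ) hα)
  have h3 := h1.mul h2
  rw [one_mul, apply_ite Complex.ofReal, Complex.ofReal_zero, Complex.ofReal_one] at h3
  refine h3.congr' ?_
  filter_upwards [eventually_ge_atTop 1] with N hN
  have hN0 : (N : ℂ) ≠ 0 := by
    rw [Nat.cast_ne_zero]
    omega
  simp only [Function.comp_apply, Complex.ofReal_div, Complex.ofReal_natCast, Complex.ofReal_pow]
  rw [← hn, pow_succ]
  field_simp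

lemma IsMomentExpansion.tendsto_sum (hw : IsMomentExpansion μ ε Finset.univ J w C) (hJ : 1 ≤ J)
    (hC1 : Tendsto (fun N : ℕ => (Zcnt N (σ N) : ℝ) / (N : ℝ) ^ 4) atTop (nhds 0)) :
    Tendsto (fun N : ℕ => (N : ℂ)⁻¹ *
        ∑ α, ∑ β, w N α β * (pairingSolutions (σ N) ε α β).card) atTop
      (nhds (ncPairings m ε : ℂ)) := by
  classical
  simp only [Finset.mul_sum]
  rw [ncPairings_eq_sum]
  refine tendsto_finsetSum _ fun α _ => tendsto_finsetSum _ fun β _ => ?_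
  by_cases hαβ : IsSignPairing ε Finset.univ α ∧ IsSignPairing ε Finset.univ β
  · obtain ⟨hα, hβ⟩ := hαβ
    by_cases hne : α = β
    · subst hne
      simpa [hα, ite_not] using hw.tendsto_self (σ := σ) hJ hα
    · simpa [hne] using hw.tendsto_of_ne hC1 hα hβ hne
  · have h0 : ∀ N, w N α β = 0 := fun N => by
      by_contra h
      exact hαβ (hw.support N α β h)
    have h1 : ¬ (α = β ∧ IsSignPairing ε Finset.univ α ∧ ¬ HasCrossing α) :=
      fun h => hαβ ⟨h.2.1, h.1 ▸ h.2.1⟩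
    simp [h0, h1]

end Limit

theorem stmt0 (μ : (N : ℕ) → Measure (Matrix (Fin N) (Fin N) ℂ))
    (hμ : ∀ N, IsHaarUnitary N (μ N))
    (σ : (N : ℕ) → Equiv.Perm (Fin N × Fin N))
    (hC1 : Tendsto (fun N : ℕ => (Zcnt N (σ N) : ℝ) / (N : ℝ) ^ 4) atTop (nhds 0))
    (m : ℕ) (hm : 1 ≤ m) (ε : Fin m → Bool) :
    Tendsto (fun N : ℕ => ∫ U, (N : ℂ)⁻¹ *
        Matrix.trace ((List.ofFn fun s : Fin m => starPow (permMat (σ N) U) (ε s)).prod) ∂(μ N))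
      atTop (nhds (ncPairings m ε : ℂ)) := by
  have : NeZero m := ⟨by omega⟩
  obtain ⟨w, C, hw⟩ := exists_isMomentExpansion hμ ε Finset.univ m
  have h1 := hw.tendsto_sum hm hC1
  suffices h2 : Tendsto (fun N : ℕ => ∫ U, (N : ℂ)⁻¹ *
        Matrix.trace ((List.ofFn fun s : Fin m => starPow (permMat (σ N) U) (ε s)).prod) ∂(μ N) -
      (N : ℂ)⁻¹ * ∑ α, ∑ β, w N α β * (pairingSolutions (σ N) ε α β).card) atTop (nhds 0) by
    simpa using h2.add h1
  refine squeeze_zero_norm' ?_ (tendsto_const_div_atTop_nhds_zero_nat C)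
  filter_upwards [eventually_ge_atTop 1] with N hN
  have hN0 : (0 : ℝ) < N := by exact_mod_cast hN
  rw [integral_trace_eq (hμ N), ← sum_pairSum, ← mul_sub, ← Finset.sum_sub_distrib, norm_mul,
    norm_inv, Complex.norm_natCast, ← div_eq_inv_mul]
  gcongr
  refine (norm_sum_le_of_le _ (n := fun _ => C / (N : ℝ) ^ m) ?_).trans_eq ?_
  · intro i _
    rw [le_div_iff₀ (by positivity)]
    exact hw.error N hN _ _
  · simp only [Finset.sum_const, Finset.card_univ, Fintype.card_pi, Fintype.card_fin,
      Finset.prod_const, nsmul_eq_mul, Nat.cast_pow]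
    field_simp
end

section
/- Fix n ≥ 1, ε: [2n] → {1,*}, pairings p, q of [2n] compatible with ε, and an interval S = {s, s+1, …, s+m} ⊆ [2n]. Suppose that for each N a 2n-tuple of permutations σ_{1,N},…,σ_{2n,N} of [N]×[N] is given, and let F_N denote the corresponding counting function. If F_N(S) = o( N^{ |S| + 1 − b(S) } ) as N → ∞, where b(S) is the number of blocks of p∨q contained in S, then F_N([2n]) = |A^{(p,q)}_N| = o( N^{ 2n + 1 − |p∨q| } ) as N → ∞. -/
open Filter

/-- `(k_s, l_s) = σ_s ∘ ε_s (i_s, j_s)`. -/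
def klMap {n N : ℕ} (ε : Fin (2 * n) → Bool) (σ : Fin (2 * n) → Equiv.Perm (Fin N × Fin N))
    (x : (Fin (2 * n) → Fin N) × (Fin (2 * n) → Fin N)) (s : Fin (2 * n)) : Fin N × Fin N :=
  if ε s then (σ s) (x.1 s, x.2 s) else (σ s) (x.2 s, x.1 s)

/-- The set `A^{(p,q)}` of tuples `(i_1, j_1, …, i_{2n}, j_{2n})` with `j_s = i_{s+1}`
(cyclically, so that `j_{2n} = i_1`), `k_s = k_{p(s)}` and `l_s = l_{q(s)}` for all `s`. -/
def tupleSet (n N : ℕ) (ε : Fin (2 * n) → Bool) (σ : Fin (2 * n) → Equiv.Perm (Fin N × Fin N))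
    (p q : Equiv.Perm (Fin (2 * n))) :
    Finset ((Fin (2 * n) → Fin N) × (Fin (2 * n) → Fin N)) :=
  Finset.univ.filter fun x =>
    (∀ s, x.2 s = x.1 (finRotate (2 * n) s)) ∧
    (∀ s, (klMap ε σ x s).1 = (klMap ε σ x (p s)).1) ∧
    (∀ s, (klMap ε σ x s).2 = (klMap ε σ x (q s)).2)

/-- `F(S)`:  the number of families `(i_s, j_s)_{s ∈ S}` that extend to an element of
`A^{(p,q)}`. -/
def Fcnt (n N : ℕ) (ε : Fin (2 * n) → Bool) (σ : Fin (2 * n) → Equiv.Perm (Fin N × Fin N))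
    (p q : Equiv.Perm (Fin (2 * n))) (S : Finset (Fin (2 * n))) : ℕ :=
  ((tupleSet n N ε σ p q).image fun x => fun s : {a // a ∈ S} => (x.1 s.1, x.2 s.1)).card

/-- The join `p ∨ q` of the two pair partitions, as an equivalence relation. -/
def joinRel {m : ℕ} (p q : Equiv.Perm (Fin m)) : Fin m → Fin m → Prop :=
  Relation.EqvGen fun a b => p a = b ∨ q a = b

/-- `|p ∨ q|`, the number of blocks of the join partition. -/
noncomputable def numBlocks {m : ℕ} (p q : Equiv.Perm (Fin m)) : ℕ :=
  Set.ncard {B : Set (Fin m) | ∃ a, B = {x | joinRel p q a x}}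

/-- The set of blocks of `p ∨ q` contained in `S`. -/
def blocksIn {m : ℕ} (p q : Equiv.Perm (Fin m)) (S : Finset (Fin m)) : Set (Set (Fin m)) :=
  {B | (∃ c, B = {x | joinRel p q c x}) ∧ ∀ x ∈ B, x ∈ S}

theorem joinRel_block_eq {m : ℕ} {p q : Equiv.Perm (Fin m)} {c t : Fin m}
    (h : joinRel p q c t) : {x | joinRel p q c x} = {x | joinRel p q t x} := by
  ext x
  exact ⟨fun hx => (h.symm).trans _ _ _ hx, fun hx => h.trans _ _ _ hx⟩

theorem blocksIn_insert_subset {m : ℕ} (p q : Equiv.Perm (Fin m)) (S : Finset (Fin m))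
    (t : Fin m) :
    blocksIn p q (insert t S) ⊆ insert {x | joinRel p q t x} (blocksIn p q S) := by
  rintro B ⟨⟨c, rfl⟩, hB⟩
  by_cases h : joinRel p q c t
  · exact Or.inl (joinRel_block_eq h)
  · refine Or.inr ⟨⟨c, rfl⟩, fun x hx => Finset.mem_of_mem_insert_of_ne (hB x hx) ?_⟩
    rintro rfl
    exact h hx

theorem ncard_blocksIn_insert_le_succ {m : ℕ} (p q : Equiv.Perm (Fin m))
    (S : Finset (Fin m)) (t : Fin m) :
    (blocksIn p q (insert t S)).ncard ≤ (blocksIn p q S).ncard + 1 :=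
  (Set.ncard_le_ncard (blocksIn_insert_subset p q S t) (Set.toFinite _)).trans
    (Set.ncard_insert_le _ _)

theorem ncard_blocksIn_insert_le {m : ℕ} (p q : Equiv.Perm (Fin m)) (S : Finset (Fin m))
    (t : Fin m) (ht : ¬ ∀ x, joinRel p q t x → x ∈ insert t S) :
    (blocksIn p q (insert t S)).ncard ≤ (blocksIn p q S).ncard := by
  refine Set.ncard_le_ncard (fun B hB => ?_) (Set.toFinite _)
  rcases blocksIn_insert_subset p q S t hB with rfl | h
  · exact absurd hB.2 ht
  · exact h

theorem card_image_le_card_image_of_factors {α β γ : Type*} [DecidableEq β] [DecidableEq γ]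
    (A : Finset α) (f : α → β) (g : α → γ)
    (h : ∀ x ∈ A, ∀ y ∈ A, g x = g y → f x = f y) :
    (A.image f).card ≤ (A.image g).card := by
  classical
  rcases A.eq_empty_or_nonempty with rfl | ⟨a, -⟩
  · simp
  have : Nonempty α := ⟨a⟩
  have hc : ∀ b ∈ A.image f, ∃ x ∈ A, f x = b := fun b hb => Finset.mem_image.1 hb
  choose! r hrA hr using hc
  refine Finset.card_le_card_of_injOn (fun b => g (r b))
    (fun b hb => Finset.mem_image_of_mem g (hrA b hb)) fun b hb c hc hbc => ?_
  rw [← hr b hb, ← hr c hc]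
  exact h _ (hrA b hb) _ (hrA c hc) hbc

section Counting

variable {n N : ℕ} {ε : Fin (2 * n) → Bool} {σ : Fin (2 * n) → Equiv.Perm (Fin N × Fin N)}
  {p q : Equiv.Perm (Fin (2 * n))} {S : Finset (Fin (2 * n))}

theorem klMap_congr {x y : (Fin (2 * n) → Fin N) × (Fin (2 * n) → Fin N)} {s : Fin (2 * n)}
    (h₁ : x.1 s = y.1 s) (h₂ : x.2 s = y.2 s) : klMap ε σ x s = klMap ε σ y s := by
  simp only [klMap, h₁, h₂]

theorem snd_eq_of_klMap_eq {x y : (Fin (2 * n) → Fin N) × (Fin (2 * n) → Fin N)}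
    {s : Fin (2 * n)} (h : klMap ε σ x s = klMap ε σ y s) : x.2 s = y.2 s := by
  unfold klMap at h
  split_ifs at h
  · exact congrArg Prod.snd ((σ s).injective h)
  · exact congrArg Prod.fst ((σ s).injective h)

theorem restrict_eq_iff {x y : (Fin (2 * n) → Fin N) × (Fin (2 * n) → Fin N)} :
    (fun s : {a // a ∈ S} => (x.1 s.1, x.2 s.1)) = (fun s => (y.1 s.1, y.2 s.1)) ↔
      ∀ s ∈ S, x.1 s = y.1 s ∧ x.2 s = y.2 s := by
  simp [funext_iff]

theorem restrict_insert_eq {x y : (Fin (2 * n) → Fin N) × (Fin (2 * n) → Fin N)}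
    (hx : x ∈ tupleSet n N ε σ p q) (hy : y ∈ tupleSet n N ε σ p q) {s : Fin (2 * n)}
    (hs : s ∈ S) (h : ∀ s ∈ S, x.1 s = y.1 s ∧ x.2 s = y.2 s)
    (ht : x.2 (finRotate (2 * n) s) = y.2 (finRotate (2 * n) s)) :
    ∀ u ∈ insert (finRotate (2 * n) s) S, x.1 u = y.1 u ∧ x.2 u = y.2 u := by
  simp only [tupleSet, Finset.mem_filter, Finset.mem_univ, true_and] at hx hy
  intro u hu
  rcases Finset.mem_insert.1 hu with rfl | hu
  · exact ⟨by rw [← hx.1, ← hy.1, (h s hs).2], ht⟩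
  · exact h u hu

theorem Fcnt_insert_le_mul {s : Fin (2 * n)} (hs : s ∈ S) :
    Fcnt n N ε σ p q (insert (finRotate (2 * n) s) S) ≤ Fcnt n N ε σ p q S * N := by
  refine (card_image_le_card_image_of_factors _ _
    (fun x => ((fun u : {a // a ∈ S} => (x.1 u.1, x.2 u.1)), x.2 (finRotate (2 * n) s)))
    fun x hx y hy hxy => ?_).trans ?_
  · rw [Prod.mk.injEq, restrict_eq_iff] at hxy
    exact restrict_eq_iff.2 (restrict_insert_eq hx hy hs hxy.1 hxy.2)
  · refine (Finset.card_le_card (t := ((tupleSet n N ε σ p q).image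
      fun x => fun u : {a // a ∈ S} => (x.1 u.1, x.2 u.1)) ×ˢ Finset.univ)
      fun z hz => ?_).trans_eq (by rw [Finset.card_product, Finset.card_fin, Fcnt])
    obtain ⟨x, hx, rfl⟩ := Finset.mem_image.1 hz
    exact Finset.mem_product.2 ⟨Finset.mem_image_of_mem _ hx, Finset.mem_univ _⟩

theorem Fcnt_insert_le {s : Fin (2 * n)} (hs : s ∈ S) (hp : p (finRotate (2 * n) s) ∈ S)
    (hq : q (finRotate (2 * n) s) ∈ S) :
    Fcnt n N ε σ p q (insert (finRotate (2 * n) s) S) ≤ Fcnt n N ε σ p q S := by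
  refine card_image_le_card_image_of_factors _ _ _ fun x hx y hy hxy => ?_
  rw [restrict_eq_iff] at hxy ⊢
  refine restrict_insert_eq hx hy hs hxy (snd_eq_of_klMap_eq (ε := ε) (σ := σ) ?_)
  simp only [tupleSet, Finset.mem_filter, Finset.mem_univ, true_and] at hx hy
  refine Prod.ext ?_ ?_
  · rw [hx.2.1, hy.2.1, klMap_congr (hxy _ hp).1 (hxy _ hp).2]
  · rw [hx.2.2, hy.2.2, klMap_congr (hxy _ hq).1 (hxy _ hq).2]

theorem Fcnt_univ : Fcnt n N ε σ p q Finset.univ = (tupleSet n N ε σ p q).card := by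
  refine Finset.card_image_of_injective _ fun x y hxy => ?_
  have h := restrict_eq_iff.1 hxy
  exact Prod.ext (funext fun s => (h s (Finset.mem_univ s)).1)
    (funext fun s => (h s (Finset.mem_univ s)).2)

theorem exists_mem_finRotate_notMem {m : ℕ} {S : Finset (Fin m)} (hS : S.Nonempty)
    (hS' : S ≠ Finset.univ) : ∃ s ∈ S, finRotate m s ∉ S := by
  by_contra! h
  apply hS'
  obtain ⟨s, hs⟩ := hS
  match m with
  | 0 => exact s.elim0
  | 1 => exact Finset.eq_univ_of_forall fun x => Subsingleton.elim s x ▸ hs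
  | m + 2 =>
    refine Finset.eq_univ_of_forall fun x => ?_
    have hmem : ∀ y, finRotate (m + 2) y ≠ y := fun y => by
      rw [← Equiv.Perm.mem_support, support_finRotate]; exact Finset.mem_univ y
    obtain ⟨k, rfl⟩ := isCycle_finRotate.exists_pow_eq (hmem s) (hmem x)
    induction k with
    | zero => exact hs
    | succ k ih => rw [pow_succ', Equiv.Perm.mul_apply]; exact h _ ih

/-- Adding the cyclic successor of an element of `S` does not increase
`F(S) N^{b(S) - |S|}`. -/
theorem Fcnt_insert_mul_pow_le (hpf : ∀ s, p s ≠ s) (hqf : ∀ s, q s ≠ s) {s : Fin (2 * n)}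
    (hs : s ∈ S) (hN : 0 < N) :
    Fcnt n N ε σ p q (insert (finRotate (2 * n) s) S) *
        N ^ (blocksIn p q (insert (finRotate (2 * n) s) S)).ncard ≤
      Fcnt n N ε σ p q S * N ^ (blocksIn p q S).ncard * N := by
  by_cases h : ∀ x, joinRel p q (finRotate (2 * n) s) x → x ∈ insert (finRotate (2 * n) s) S
  · have hp := Finset.mem_of_mem_insert_of_ne
      (h _ (Relation.EqvGen.rel _ _ (Or.inl rfl))) (hpf _)
    have hq := Finset.mem_of_mem_insert_of_ne
      (h _ (Relation.EqvGen.rel _ _ (Or.inr rfl))) (hqf _)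
    rw [mul_assoc, ← pow_succ]
    exact Nat.mul_le_mul (Fcnt_insert_le hs hp hq)
      (Nat.pow_le_pow_right hN (ncard_blocksIn_insert_le_succ p q S _))
  · rw [mul_right_comm]
    exact Nat.mul_le_mul (Fcnt_insert_le_mul hs)
      (Nat.pow_le_pow_right hN (ncard_blocksIn_insert_le p q S _ h))

theorem card_tupleSet_mul_pow_le (hpf : ∀ s, p s ≠ s) (hqf : ∀ s, q s ≠ s) (hN : 0 < N)
    (S : Finset (Fin (2 * n))) (hS : S.Nonempty) :
    (tupleSet n N ε σ p q).card * N ^ numBlocks p q * N ^ S.card ≤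
      Fcnt n N ε σ p q S * N ^ (blocksIn p q S).ncard * N ^ (2 * n) := by
  by_cases hu : S = Finset.univ
  · subst hu
    rw [Fcnt_univ, Finset.card_fin]
    simp [numBlocks, blocksIn]
  · obtain ⟨s, hs, ht⟩ := exists_mem_finRotate_notMem hS hu
    have hlt : (insert (finRotate (2 * n) s) S).card ≤ 2 * n := by
      simpa using Finset.card_le_univ (insert (finRotate (2 * n) s) S)
    have ih := card_tupleSet_mul_pow_le hpf hqf hN _
      (Finset.insert_nonempty (finRotate (2 * n) s) S)
    rw [Finset.card_insert_of_notMem ht] at ih hlt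
    refine Nat.le_of_mul_le_mul_right ?_ hN
    calc _ = (tupleSet n N ε σ p q).card * N ^ numBlocks p q * N ^ (S.card + 1) := by ring
      _ ≤ _ := ih
      _ ≤ _ := Nat.mul_le_mul_right _ (Fcnt_insert_mul_pow_le hpf hqf hs hN)
      _ = _ := by ring
termination_by 2 * n - S.card
decreasing_by
  rw [Finset.card_insert_of_notMem ht] at *
  omega

end Counting

/-- If `F_N(S) = o(N^{|S| + 1 - b(S)})` on the interval `S = Icc a b`, where `b(S)` is the
number of blocks of `p ∨ q` contained in `S`, then
`F_N([2n]) = |A^{(p,q)}_N| = o(N^{2n + 1 - |p∨q|})`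
(the `o`-statements are phrased by multiplying both sides by the `N`-power of the number of
blocks). -/
theorem stmt8 (n : ℕ) (hn : 1 ≤ n)
    (ε : Fin (2 * n) → Bool)
    (p q : Equiv.Perm (Fin (2 * n)))
    (hp : Function.Involutive p) (hq : Function.Involutive q)
    (hpf : ∀ s, p s ≠ s) (hqf : ∀ s, q s ≠ s)
    (hpε : ∀ s, ε (p s) ≠ ε s) (hqε : ∀ s, ε (q s) ≠ ε s)
    (a b : Fin (2 * n)) (hab : a ≤ b)
    (σ : (N : ℕ) → Fin (2 * n) → Equiv.Perm (Fin N × Fin N))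
    (hS : Tendsto (fun N : ℕ =>
        (Fcnt n N ε (σ N) p q (Finset.Icc a b) : ℝ) *
          (N : ℝ) ^ (Set.ncard {B : Set (Fin (2 * n)) | (∃ c, B = {x | joinRel p q c x}) ∧
            ∀ x ∈ B, x ∈ Finset.Icc a b}) /
          (N : ℝ) ^ ((Finset.Icc a b).card + 1)) atTop (nhds 0)) :
    Tendsto (fun N : ℕ =>
        ((tupleSet n N ε (σ N) p q).card : ℝ) * (N : ℝ) ^ numBlocks p q /
          (N : ℝ) ^ (2 * n + 1)) atTop (nhds 0) := by
  refine squeeze_zero' (Eventually.of_forall fun N => by positivity) ?_ hS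
  filter_upwards [eventually_gt_atTop 0] with N hN
  have key := card_tupleSet_mul_pow_le (ε := ε) (σ := σ N) hpf hqf hN _
    (Finset.nonempty_Icc.2 hab)
  have hN' : (0 : ℝ) < N := by exact_mod_cast hN
  rw [div_le_div_iff₀ (by positivity) (by positivity), pow_succ, pow_succ, ← mul_assoc,
    ← mul_assoc]
  refine mul_le_mul_of_nonneg_right ?_ hN'.le
  exact_mod_cast key
end
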